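/- arXiv:2008.13181 — 10 statements merged into one kernel-verified Lean document; each statement's English description precedes it below -/
import Mathlib

section
/- Let A be a finite FL_ew-algebra that is projective in the class of all FL_ew-algebras. Then A has exactly two elements; more precisely, 0 ≠ 1 in A and every element of A equals 0 or 1 (so A is isomorphic to the two-element FL_ew-algebra 2). -/
/-- An FL_ew-algebra: a bounded lattice (with least element `⊥` playing the
role of `0` and greatest element `⊤` playing the role of `1`) equipped with a
commutative monoid operation `mul` with unit `⊤`, residuated by `himp`. -/
class FLew (α : Type) extends Lattice α, BoundedOrder α where
  mul : α → α → α
  himp : α → α → α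
  mul_comm : ∀ a b : α, mul a b = mul b a
  mul_assoc : ∀ a b c : α, mul (mul a b) c = mul a (mul b c)
  mul_top : ∀ a : α, mul a ⊤ = a
  residuation : ∀ a b c : α, mul a b ≤ c ↔ a ≤ himp b c

/-- A homomorphism of FL_ew-algebras preserves `⊔`, `⊓`, `·`, `→`, `⊥` and `⊤`. -/
def IsFLewHom {α β : Type} [FLew α] [FLew β] (f : α → β) : Prop :=
  (∀ a b : α, f (a ⊔ b) = f a ⊔ f b) ∧
  (∀ a b : α, f (a ⊓ b) = f a ⊓ f b) ∧
  (∀ a b : α, f (FLew.mul a b) = FLew.mul (f a) (f b)) ∧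
  (∀ a b : α, f (FLew.himp a b) = FLew.himp (f a) (f b)) ∧
  f ⊥ = ⊥ ∧ f ⊤ = ⊤

/-- `A` is projective in the class of all FL_ew-algebras. -/
def FLewProjective (A : Type) [FLew A] : Prop :=
  ∀ (B C : Type) [FLew B] [FLew C],
    ∀ (h : A → C) (g : B → C), IsFLewHom h → IsFLewHom g → Function.Surjective g →
      ∃ f : A → B, IsFLewHom f ∧ g ∘ f = h

/-- The cover of `A`: pairs `(a, n)` with `n : ℕ∞` (order reversed), `n = 0` only for `a = ⊤`. -/
@[ext] structure Cov (A : Type) [FLew A] where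
  fst : A
  snd : ℕ∞
  prop : snd = 0 → fst = ⊤

namespace Cov
variable {A : Type} [FLew A]

open Classical in
/-- interior operator, second coordinate -/
noncomputable def sg (x : A) (n : ℕ∞) : ℕ∞ := if x = ⊤ then n else max n 1

lemma sg_prop (x : A) (n : ℕ∞) : sg x n = 0 → x = ⊤ := by
  unfold sg
  split_ifs with h
  · exact fun _ => h
  · intro h0
    have : (1 : ℕ∞) ≤ max n 1 := le_max_right _ _
    rw [h0] at this
    simp at this

lemma sg_le_iff (p : Cov A) (x : A) (n : ℕ∞) (h : p.fst ≤ x) : sg x n ≤ p.snd ↔ n ≤ p.snd := by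
  unfold sg
  split_ifs with hx
  · exact Iff.rfl
  · have : p.snd ≠ 0 := fun h0 => hx (top_le_iff.1 (p.prop h0 ▸ h))
    rw [max_le_iff, Order.one_le_iff_ne_zero]
    exact ⟨fun h => h.1, fun h => ⟨h, this⟩⟩

noncomputable instance : FLew (Cov A) where
  le p q := p.fst ≤ q.fst ∧ q.snd ≤ p.snd
  le_refl p := ⟨le_rfl, le_rfl⟩
  le_trans p q r h k := ⟨h.1.trans k.1, k.2.trans h.2⟩
  le_antisymm p q h k := Cov.ext (le_antisymm h.1 k.1) (le_antisymm k.2 h.2)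
  sup p q := ⟨p.fst ⊔ q.fst, min p.snd q.snd, fun h => by
    rcases min_choice p.snd q.snd with h' | h'
    · rw [p.prop (h' ▸ h)]; simp
    · rw [q.prop (h' ▸ h)]; simp⟩
  le_sup_left p q := ⟨le_sup_left, min_le_left _ _⟩
  le_sup_right p q := ⟨le_sup_right, min_le_right _ _⟩
  sup_le p q r h k := ⟨sup_le h.1 k.1, le_min h.2 k.2⟩
  inf p q := ⟨p.fst ⊓ q.fst, sg (p.fst ⊓ q.fst) (max p.snd q.snd), sg_prop _ _⟩
  inf_le_left p q := ⟨inf_le_left, by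
    show p.snd ≤ sg _ _
    unfold sg; split_ifs <;> simp⟩
  inf_le_right p q := ⟨inf_le_right, by
    show q.snd ≤ sg _ _
    unfold sg; split_ifs <;> simp⟩
  le_inf p q r h k := ⟨le_inf h.1 k.1, (sg_le_iff p _ _ (le_inf h.1 k.1)).2 (max_le h.2 k.2)⟩
  top := ⟨⊤, 0, fun _ => rfl⟩
  le_top p := ⟨le_top, zero_le⟩
  bot := ⟨⊥, ⊤, fun h => by simp at h⟩
  bot_le p := ⟨bot_le, le_top⟩
  mul p q := ⟨FLew.mul p.fst q.fst, p.snd + q.snd, fun h => by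
    rw [add_eq_zero] at h
    rw [p.prop h.1, q.prop h.2, FLew.mul_top]⟩
  himp p q := ⟨FLew.himp p.fst q.fst, sg (FLew.himp p.fst q.fst) (q.snd - p.snd), sg_prop _ _⟩
  mul_comm p q := Cov.ext (FLew.mul_comm _ _) (add_comm _ _)
  mul_assoc p q r := Cov.ext (FLew.mul_assoc _ _ _) (add_assoc _ _ _)
  mul_top p := Cov.ext (FLew.mul_top _) (add_zero _)
  residuation p q r := by
    show (FLew.mul p.fst q.fst ≤ r.fst ∧ r.snd ≤ p.snd + q.snd) ↔
      (p.fst ≤ FLew.himp q.fst r.fst ∧ sg (FLew.himp q.fst r.fst) (r.snd - q.snd) ≤ p.snd)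
    rw [FLew.residuation]
    refine and_congr_right fun h => ?_
    rw [sg_le_iff p _ _ h, tsub_le_iff_right]

end Cov

/-- The only finite projective algebra in FL_ew is the two-element algebra `2`. -/
theorem finite_projective_FLew_is_two (A : Type) [FLew A] [Finite A]
    (hproj : FLewProjective A) :
    (⊥ : A) ≠ ⊤ ∧ ∀ a : A, a = ⊥ ∨ a = ⊤ := by
  obtain ⟨f, ⟨-, -, fmul, fimp, fbot, ftop⟩, hf⟩ := hproj (Cov A) A id Cov.fst
    ⟨fun _ _ => rfl, fun _ _ => rfl, fun _ _ => rfl, fun _ _ => rfl, rfl, rfl⟩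
    ⟨fun _ _ => rfl, fun _ _ => rfl, fun _ _ => rfl, fun _ _ => rfl, rfl, rfl⟩
    (fun a => ⟨⟨a, ⊤, fun h => by simp at h⟩, rfl⟩)
  have hfst : ∀ a, (f a).fst = a := fun a => congrFun hf a
  have hbot : (f ⊥).snd = ⊤ := by rw [fbot]; rfl
  have htop : (f ⊤).snd = 0 := by rw [ftop]; rfl
  have key : ∀ a : A, (f a).snd ≠ ⊤ → a = ⊤ := by
    intro a ha
    obtain ⟨k, hk⟩ := ENat.ne_top_iff_exists.1 ha
    let pw : ℕ → A := fun n => Nat.rec ⊤ (fun _ x => FLew.mul x a) n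
    have hpw : ∀ n : ℕ, (f (pw n)).snd = ((n * k : ℕ) : ℕ∞) := by
      intro n
      induction n with
      | zero => simpa [pw] using htop
      | succ n ih =>
        have h1 : f (pw (n + 1)) = FLew.mul (f (pw n)) (f a) := fmul _ _
        have h2 : (FLew.mul (f (pw n)) (f a)).snd = (f (pw n)).snd + (f a).snd := rfl
        rw [h1, h2, ih, ← hk, Nat.succ_mul, Nat.cast_add]
    obtain ⟨m, n, hmn, he⟩ := Finite.exists_ne_map_eq_of_infinite pw
    have h3 : m * k = n * k := by
      have := hpw m
      rw [he, hpw n] at this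
      exact_mod_cast this.symm
    have h4 : k = 0 := by
      by_contra h
      exact hmn (Nat.eq_of_mul_eq_mul_right (Nat.pos_of_ne_zero h) h3)
    have := (f a).prop (by rw [← hk, h4]; rfl)
    rwa [hfst] at this
  refine ⟨fun h => ?_, fun a => ?_⟩
  · rw [h, htop] at hbot
    simp at hbot
  · by_cases ha : (f a).snd = ⊤
    · left
      have h1 : FLew.himp a (⊥ : A) = ⊤ := by
        apply key
        rw [fimp]
        show Cov.sg _ ((f ⊥).snd - (f a).snd) ≠ ⊤
        rw [hbot, ha]
        have : (⊤ : ℕ∞) - ⊤ = 0 := tsub_self _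
        rw [this]
        unfold Cov.sg
        split_ifs <;> simp
      have h2 := (FLew.residuation ⊤ a ⊥).2 (le_of_eq h1.symm)
      rw [FLew.mul_comm, FLew.mul_top] at h2
      exact le_bot_iff.1 h2
    · exact Or.inr (key a ha)
end

section
/- Let A be an FL_ew-algebra projective in the class of all FL_ew-algebras. Then 1 is join-irreducible in A: for all a, b ∈ A, if a ∨ b = 1 then a = 1 or b = 1. If moreover A is finite, then the set A \ {1} has a greatest element (equivalently, A is subdirectly irreducible). -/
open Classical in
/-- Multiplication on `A` with a new top (unit) added. -/
noncomputable def topMul {A : Type} [FLew A] : WithTop A → WithTop A → WithTop A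
  | none, y => y
  | some x, none => some x
  | some x, some y => some (FLew.mul x y)

open Classical in
/-- Residual on `A` with a new top added. -/
noncomputable def topImp {A : Type} [FLew A] : WithTop A → WithTop A → WithTop A
  | none, y => y
  | some _, none => none
  | some x, some y => if x ≤ y then none else some (FLew.himp x y)

theorem FLew_mul_le_right {A : Type} [FLew A] (a b : A) : FLew.mul a b ≤ b := by
  rw [FLew.residuation]
  refine le_trans le_top ?_
  rw [← FLew.residuation, FLew.mul_comm, FLew.mul_top]

theorem FLew_himp_top {A : Type} [FLew A] (x y : A) (h : x ≤ y) : FLew.himp x y = ⊤ := by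
  rw [eq_top_iff, ← FLew.residuation, FLew.mul_comm, FLew.mul_top]
  exact h

theorem FLew_top_himp {A : Type} [FLew A] (y : A) : FLew.himp ⊤ y = y := by
  apply le_antisymm
  · rw [← FLew.mul_top (FLew.himp ⊤ y), FLew.residuation]
  · rw [← FLew.residuation, FLew.mul_top]

theorem topImp_coe_of_le {A : Type} [FLew A] (x y : A) (h : x ≤ y) :
    topImp (x : WithTop A) (y : WithTop A) = ⊤ := if_pos h

theorem topImp_coe_of_not_le {A : Type} [FLew A] (x y : A) (h : ¬ x ≤ y) :
    topImp (x : WithTop A) (y : WithTop A) = (FLew.himp x y : A) := if_neg h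

theorem topImp_top_left {A : Type} [FLew A] (y : WithTop A) : topImp ⊤ y = y := rfl

theorem topImp_top_right {A : Type} [FLew A] (x : WithTop A) : topImp x ⊤ = ⊤ := by
  cases x <;> rfl

theorem topMul_top_left {A : Type} [FLew A] (y : WithTop A) : topMul ⊤ y = y := rfl

theorem topMul_top_right {A : Type} [FLew A] (x : WithTop A) : topMul x ⊤ = x := by
  cases x <;> rfl

theorem topMul_coe {A : Type} [FLew A] (x y : A) :
    topMul (x : WithTop A) (y : WithTop A) = (FLew.mul x y : A) := rfl

/-- `A` with a new top added is an FL_ew-algebra. -/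
noncomputable instance instFLewWithTop {A : Type} [FLew A] : FLew (WithTop A) where
  mul := topMul
  himp := topImp
  mul_comm a b := by
    induction a <;> induction b <;>
      simp [topMul_top_left, topMul_top_right, topMul_coe, FLew.mul_comm]
  mul_assoc a b c := by
    induction a <;> induction b <;> induction c <;>
      simp [topMul_top_left, topMul_top_right, topMul_coe, FLew.mul_assoc]
  mul_top := topMul_top_right
  residuation a b c := by
    induction c with
    | top => simp [topImp_top_right]
    | coe c =>
    induction b with
    | top => simp [topImp_top_left, topMul_top_right]
    | coe b =>
    by_cases h : b ≤ c
    · rw [topImp_coe_of_le _ _ h]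
      induction a with
      | top => simp [topMul_top_left, h]
      | coe a => simp [topMul_coe, le_trans (FLew_mul_le_right a b) h]
    · rw [topImp_coe_of_not_le _ _ h]
      induction a with
      | top => simp [topMul_top_left, h]
      | coe a => simp [topMul_coe, FLew.residuation]

theorem untop_isFLewHom (A : Type) [FLew A] :
    IsFLewHom (WithTop.untopD (⊤ : A)) := by
  refine ⟨?_, ?_, ?_, ?_, rfl, rfl⟩
  · intro a b
    induction a <;> induction b <;> simp [← WithTop.coe_sup]
  · intro a b
    induction a <;> induction b <;> simp [← WithTop.coe_inf]
  · intro a b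
    change WithTop.untopD ⊤ (topMul a b) = _
    induction a <;> induction b <;>
      simp [topMul_top_left, topMul_top_right, topMul_coe, FLew.mul_top]
    all_goals rw [FLew.mul_comm, FLew.mul_top]
  · intro a b
    change WithTop.untopD ⊤ (topImp a b) = _
    induction a with
    | top => simp [topImp_top_left, FLew_top_himp]
    | coe a =>
    induction b with
    | top => simp [topImp_top_right, FLew_himp_top]
    | coe b =>
    by_cases h : a ≤ b
    · simp [topImp_coe_of_le _ _ h, FLew_himp_top _ _ h]
    · simp [topImp_coe_of_not_le _ _ h]

/-- If `A` is projective in FL_ew then `1` (`= ⊤`) is join-irreducible in `A`;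
if moreover `A` is finite, then `A \ {⊤}` has a greatest element (equivalently,
`A` is subdirectly irreducible). -/
theorem projective_FLew_top_join_irreducible (A : Type) [FLew A]
    (hproj : FLewProjective A) :
    (∀ a b : A, a ⊔ b = ⊤ → a = ⊤ ∨ b = ⊤) ∧
    (Finite A → ∃ m : A, m ≠ ⊤ ∧ ∀ a : A, a ≠ ⊤ → a ≤ m) := by
  obtain ⟨f, hf, hgf⟩ := hproj (WithTop A) A id (WithTop.untopD ⊤)
    ⟨fun _ _ => rfl, fun _ _ => rfl, fun _ _ => rfl, fun _ _ => rfl, rfl, rfl⟩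
    (untop_isFLewHom A) (fun a => ⟨a, rfl⟩)
  obtain ⟨hsup, -, -, -, hbot, htop⟩ := hf
  have key : ∀ a, f a = ⊤ → a = ⊤ := by
    intro a ha
    have := congrFun hgf a
    simpa [ha] using this.symm
  have hne : (⊥ : A) ≠ ⊤ := by
    intro h
    rw [h, htop] at hbot
    exact WithTop.coe_ne_top (a := (⊥ : A)) hbot.symm
  have hji : ∀ a b : A, a ⊔ b = ⊤ → a = ⊤ ∨ b = ⊤ := by
    intro a b hab
    have h1 : f a ⊔ f b = ⊤ := by rw [← hsup, hab, htop]
    by_contra! hc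
    have ha : f a ≠ ⊤ := fun h => hc.1 (key a h)
    have hb : f b ≠ ⊤ := fun h => hc.2 (key b h)
    obtain ⟨x, hx⟩ := WithTop.ne_top_iff_exists.mp ha
    obtain ⟨y, hy⟩ := WithTop.ne_top_iff_exists.mp hb
    rw [← hx, ← hy] at h1
    exact WithTop.coe_ne_top (a := x ⊔ y) h1
  refine ⟨hji, fun hfin => ?_⟩
  obtain ⟨m, hm⟩ := (Set.toFinite {a : A | a ≠ ⊤}).exists_maximal ⟨⊥, hne⟩
  refine ⟨m, hm.1, fun a ha => ?_⟩
  have h2 : a ⊔ m ≠ ⊤ := fun h => (hji a m h).elim ha hm.1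
  exact le_trans le_sup_left (hm.2 h2 le_sup_right)
end

section
/- Let A be a Heyting algebra projective in HA. Then ⊤ is join-irreducible in A: for all a, b ∈ A, if a ⊔ b = ⊤ then a = ⊤ or b = ⊤. If moreover A is finite, then the set A \ {⊤} has a greatest element. -/
/-- `A` is projective in the class HA of all Heyting algebras. -/
def HeytingProjective (A : Type) [HeytingAlgebra A] : Prop :=
  ∀ (B C : Type) [HeytingAlgebra B] [HeytingAlgebra C],
    ∀ (h : HeytingHom A C) (g : HeytingHom B C), Function.Surjective g →
      ∃ f : HeytingHom A B, ∀ a : A, g (f a) = h a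

open Classical in
/-- The implication on `A` with a new top element adjoined. -/
noncomputable def wtHimp {A : Type} [HeytingAlgebra A] : WithTop A → WithTop A → WithTop A
  | _, none => ⊤
  | none, some b => some b
  | some a, some b => if a ≤ b then ⊤ else some (a ⇨ b)

theorem wtHimp_top_right {A : Type} [HeytingAlgebra A] (x : WithTop A) : wtHimp x ⊤ = ⊤ := by
  cases x <;> rfl

theorem wtHimp_top_left {A : Type} [HeytingAlgebra A] (b : A) :
    wtHimp ⊤ (b : WithTop A) = b := rfl

open Classical in
theorem wtHimp_coe {A : Type} [HeytingAlgebra A] (a b : A) :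
    wtHimp (a : WithTop A) (b : WithTop A) = if a ≤ b then ⊤ else ((a ⇨ b : A) : WithTop A) := rfl

theorem le_wtHimp_iff {A : Type} [HeytingAlgebra A] (x y z : WithTop A) :
    x ≤ wtHimp y z ↔ x ⊓ y ≤ z := by
  induction z using WithTop.recTopCoe with
  | top => simp [wtHimp_top_right]
  | coe c =>
    induction y using WithTop.recTopCoe with
    | top => simp [wtHimp_top_left]
    | coe b =>
      rw [wtHimp_coe]
      induction x using WithTop.recTopCoe with
      | top => split_ifs with h <;> simp [h]
      | coe a =>
        rw [← WithTop.coe_inf, WithTop.coe_le_coe]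
        split_ifs with h
        · simp [inf_le_of_right_le h]
        · rw [WithTop.coe_le_coe, le_himp_iff]

/-- `A` with a new top element adjoined, as a Heyting algebra. -/
noncomputable abbrev wtHeyting (A : Type) [HeytingAlgebra A] : HeytingAlgebra (WithTop A) :=
  HeytingAlgebra.ofHImp wtHimp le_wtHimp_iff

/-- The collapse of the new top. -/
def wtFun {A : Type} [HeytingAlgebra A] : WithTop A → A
  | none => ⊤
  | some a => a

theorem wtFun_top {A : Type} [HeytingAlgebra A] : wtFun (⊤ : WithTop A) = ⊤ := rfl

theorem wtFun_coe {A : Type} [HeytingAlgebra A] (a : A) : wtFun (a : WithTop A) = a := rfl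

/-- If `A` is projective in HA then `⊤` is join-irreducible in `A`; if
moreover `A` is finite, then `A \ {⊤}` has a greatest element. -/
theorem projective_Heyting_top_join_irreducible (A : Type) [HeytingAlgebra A]
    (hproj : HeytingProjective A) :
    (∀ a b : A, a ⊔ b = ⊤ → a = ⊤ ∨ b = ⊤) ∧
    (Finite A → ∃ m : A, m ≠ ⊤ ∧ ∀ a : A, a ≠ ⊤ → a ≤ m) := by
  letI : HeytingAlgebra (WithTop A) := wtHeyting A
  let g : HeytingHom (WithTop A) A :=
    { toFun := wtFun
      map_sup' := by
        intro x y
        induction x using WithTop.recTopCoe <;> induction y using WithTop.recTopCoe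
        · exact (sup_idem (⊤ : A)).symm
        · exact (top_sup_eq _).symm
        · exact (sup_top_eq _).symm
        · rfl
      map_inf' := by
        intro x y
        induction x using WithTop.recTopCoe <;> induction y using WithTop.recTopCoe
        · exact (inf_idem (⊤ : A)).symm
        · exact (top_inf_eq _).symm
        · exact (inf_top_eq _).symm
        · rfl
      map_bot' := rfl
      map_himp' := by
        intro x y
        change wtFun (wtHimp x y) = _
        induction y using WithTop.recTopCoe with
        | top => rw [wtHimp_top_right, wtFun_top, himp_top]
        | coe b =>
          induction x using WithTop.recTopCoe with
          | top => rw [wtHimp_top_left, wtFun_top, wtFun_coe, top_himp]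
          | coe a =>
            rw [wtHimp_coe, wtFun_coe, wtFun_coe]
            split_ifs with h
            · rw [wtFun_top, himp_eq_top_iff.2 h]
            · rfl }
  obtain ⟨f, hf⟩ := hproj (WithTop A) A (HeytingHom.id A) g (fun a => ⟨(a : WithTop A), rfl⟩)
  have hf' : ∀ a, wtFun (f a) = a := hf
  have htop : ∀ a, f a = (⊤ : WithTop A) → a = ⊤ := fun a h => by
    rw [← hf' a, h]; rfl
  have hft : f ⊤ = (⊤ : WithTop A) := map_top f
  have hirr : ∀ a b : A, a ⊔ b = ⊤ → a = ⊤ ∨ b = ⊤ := by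
    intro a b hab
    have h1 : f a ⊔ f b = (⊤ : WithTop A) := by
      rw [← hft, ← hab]; exact (map_sup f a b).symm
    have key : ∀ x y : WithTop A, x ⊔ y = ⊤ → x = ⊤ ∨ y = ⊤ := by
      intro x y h
      induction x using WithTop.recTopCoe with
      | top => exact Or.inl rfl
      | coe a =>
        induction y using WithTop.recTopCoe with
        | top => exact Or.inr rfl
        | coe b => exact absurd h (WithTop.coe_ne_top (a := a ⊔ b))
    exact (key _ _ h1).imp (htop a) (htop b)
  have hbt : (⊥ : A) ≠ ⊤ := by
    intro h
    have h1 : f ⊥ = ((⊥ : A) : WithTop A) := map_bot f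
    rw [h, hft] at h1
    exact WithTop.top_ne_coe h1
  refine ⟨hirr, fun hfin => ?_⟩
  classical
  haveI := Fintype.ofFinite A
  refine ⟨(Finset.univ.filter (fun a : A => a ≠ ⊤)).sup id, ?_, fun a ha => ?_⟩
  · refine Finset.sup_induction (p := fun a : A => a ≠ ⊤) hbt ?_ ?_
    · intro a ha b hb hab
      exact (hirr a b hab).elim ha hb
    · intro a ha
      exact (Finset.mem_filter.1 ha).2
  · exact Finset.le_sup (f := id) (Finset.mem_filter.2 ⟨Finset.mem_univ a, ha⟩)
end

section
/- Let A be a finite HL-algebra that is projective in the class of all HL-algebras. Then the set A \ {1} has a greatest element (equivalently, A is isomorphic to an ordinal sum B ⊕ 2 for some finite HL-algebra B). -/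
/-- An HL-algebra is an FL_ew-algebra satisfying divisibility:
`x·(x → y) = y·(y → x)`. -/
def IsHL (α : Type) [FLew α] : Prop :=
  ∀ a b : α, FLew.mul a (FLew.himp a b) = FLew.mul b (FLew.himp b a)

/-- `A` is projective in the class of all HL-algebras. -/
def HLProjective (A : Type) [FLew A] : Prop :=
  ∀ (B C : Type) [FLew B] [FLew C], IsHL B → IsHL C →
    ∀ (h : A → C) (g : B → C), IsFLewHom h → IsFLewHom g → Function.Surjective g →
      ∃ f : A → B, IsFLewHom f ∧ g ∘ f = h

namespace HLAux

variable {A : Type} [FLew A]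

theorem himp_eq_top {a b : A} (h : a ≤ b) : FLew.himp a b = ⊤ := by
  apply top_le_iff.mp
  rw [← FLew.residuation, FLew.mul_comm, FLew.mul_top]
  exact h

theorem le_of_himp {a b : A} (h : (⊤ : A) ≤ FLew.himp a b) : a ≤ b := by
  rw [← FLew.residuation, FLew.mul_comm, FLew.mul_top] at h
  exact h

theorem top_himp (b : A) : FLew.himp ⊤ b = b := by
  apply le_antisymm
  · have := (FLew.residuation (FLew.himp ⊤ b) ⊤ b).2 le_rfl
    rwa [FLew.mul_top] at this
  · rw [← FLew.residuation, FLew.mul_top]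

/-- Multiplication on the ordinal sum of `A` and the two-element algebra. -/
def wmul : WithTop A → WithTop A → WithTop A
  | ⊤, y => y
  | (a : A), ⊤ => (a : WithTop A)
  | (a : A), (b : A) => ((FLew.mul a b : A) : WithTop A)

open Classical in
/-- Residuum on the ordinal sum of `A` and the two-element algebra. -/
noncomputable def whimp : WithTop A → WithTop A → WithTop A
  | _, ⊤ => ⊤
  | ⊤, (b : A) => (b : WithTop A)
  | (a : A), (b : A) => if a ≤ b then ⊤ else ((FLew.himp a b : A) : WithTop A)

/-- The quotient map. -/
def wg : WithTop A → A
  | ⊤ => ⊤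
  | (a : A) => a

@[simp] theorem wmul_tl (y : WithTop A) : wmul ⊤ y = y := rfl
@[simp] theorem wmul_tr (x : WithTop A) : wmul x ⊤ = x := by cases x <;> rfl
@[simp] theorem wmul_cc (a b : A) : wmul (a : WithTop A) b = ((FLew.mul a b : A) : WithTop A) := rfl
@[simp] theorem whimp_tr (x : WithTop A) : whimp x ⊤ = ⊤ := by cases x <;> rfl
@[simp] theorem whimp_tc (b : A) : whimp (⊤ : WithTop A) b = b := rfl
open Classical in
theorem whimp_cc (a b : A) : whimp (a : WithTop A) b =
    if a ≤ b then ⊤ else ((FLew.himp a b : A) : WithTop A) := rfl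
@[simp] theorem wg_top : wg (⊤ : WithTop A) = ⊤ := rfl
@[simp] theorem wg_coe (a : A) : wg (a : WithTop A) = a := rfl

noncomputable instance : FLew (WithTop A) where
  mul := wmul
  himp := whimp
  mul_comm x y := by
    cases x <;> cases y <;> simp [FLew.mul_comm]
  mul_assoc x y z := by
    cases x <;> cases y <;> cases z <;> simp [FLew.mul_assoc]
  mul_top x := by simp
  residuation x y z := by
    induction z using WithTop.recTopCoe with
    | top => simp
    | coe c =>
      induction y using WithTop.recTopCoe with
      | top => simp
      | coe b =>
        rw [whimp_cc]
        induction x using WithTop.recTopCoe with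
        | top =>
          split_ifs with h <;> simp [h]
        | coe a =>
          split_ifs with h
          · simp only [wmul_cc, WithTop.coe_le_coe, le_top, iff_true]
            rw [FLew.residuation, himp_eq_top h]
            exact le_top
          · simp only [wmul_cc, WithTop.coe_le_coe]
            exact FLew.residuation a b c

theorem mul_def (x y : WithTop A) : FLew.mul x y = wmul x y := rfl
theorem himp_def (x y : WithTop A) : FLew.himp x y = whimp x y := rfl

theorem wmul_whimp (a b : A) :
    wmul (a : WithTop A) (whimp (a : WithTop A) b) =
      ((FLew.mul a (FLew.himp a b) : A) : WithTop A) := by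
  rw [whimp_cc]
  split_ifs with h
  · rw [himp_eq_top h, FLew.mul_top, wmul_tr]
  · rfl

theorem isHL (hA : IsHL A) : IsHL (WithTop A) := by
  intro x y
  simp only [mul_def, himp_def]
  induction x using WithTop.recTopCoe with
  | top => cases y <;> simp
  | coe a =>
    induction y using WithTop.recTopCoe with
    | top => simp
    | coe b => rw [wmul_whimp, wmul_whimp, hA a b]

theorem wg_hom : IsFLewHom (wg : WithTop A → A) := by
  refine ⟨?_, ?_, ?_, ?_, rfl, rfl⟩
  · intro x y
    cases x <;> cases y <;> simp [← WithTop.coe_sup]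
  · intro x y
    cases x <;> cases y <;> simp [← WithTop.coe_inf]
  · intro x y
    simp only [mul_def]
    cases x <;> cases y <;> simp [FLew.mul_top, FLew.mul_comm ⊤]
  · intro x y
    simp only [himp_def]
    induction y using WithTop.recTopCoe with
    | top => simp [himp_eq_top]
    | coe b =>
      induction x using WithTop.recTopCoe with
      | top => simp [top_himp]
      | coe a =>
        rw [whimp_cc]
        split_ifs with h
        · simp [himp_eq_top h]
        · rfl

end HLAux

/-- A finite HL-algebra that is projective in the class of HL-algebras has a
greatest element below `⊤` (equivalently, it is of the form `B ⊕ 2`). -/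
theorem finite_projective_HL_has_coatom_max (A : Type) [FLew A] [Finite A]
    (hA : IsHL A) (hproj : HLProjective A) :
    ∃ m : A, m ≠ ⊤ ∧ ∀ a : A, a ≠ ⊤ → a ≤ m := by
  classical
  obtain ⟨f, ⟨hsup, -, -, -, hbot, htop⟩, hgf⟩ := hproj (WithTop A) A (HLAux.isHL hA) hA id HLAux.wg
    ⟨fun _ _ => rfl, fun _ _ => rfl, fun _ _ => rfl, fun _ _ => rfl, rfl, rfl⟩
    HLAux.wg_hom (fun a => ⟨(a : WithTop A), rfl⟩)
  have hne : ∀ a : A, a ≠ ⊤ → f a ≠ ⊤ := by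
    intro a ha h
    have := congrFun hgf a
    simp only [Function.comp, h, HLAux.wg_top, id] at this
    exact ha this.symm
  have hbt : (⊥ : A) ≠ ⊤ := by
    intro h
    rw [h, htop] at hbot
    exact WithTop.top_ne_coe (hbot : (⊤ : WithTop A) = ((⊥ : A) : WithTop A))
  have hjoin : ∀ a b : A, a ≠ ⊤ → b ≠ ⊤ → a ⊔ b ≠ ⊤ := by
    intro a b ha hb h
    have h1 := hsup a b
    rw [h, htop] at h1
    obtain ⟨u, hu⟩ := WithTop.ne_top_iff_exists.mp (hne a ha)
    obtain ⟨v, hv⟩ := WithTop.ne_top_iff_exists.mp (hne b hb)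
    rw [← hu, ← hv] at h1
    exact WithTop.top_ne_coe (h1 : (⊤ : WithTop A) = ((u ⊔ v : A) : WithTop A))
  have := Fintype.ofFinite A
  refine ⟨(Finset.univ.filter (fun a : A => a ≠ ⊤)).sup id, ?_, ?_⟩
  · exact Finset.sup_induction (p := fun a : A => a ≠ ⊤) hbt
      (fun a ha b hb => hjoin a b ha hb) (fun a ha => (Finset.mem_filter.mp ha).2)
  · intro a ha
    exact Finset.le_sup (f := id) (Finset.mem_filter.mpr ⟨Finset.mem_univ a, ha⟩)
end

section
/- Every finite Heyting algebra that is zero-projective in HA has at most two atoms: the set {a ∈ A : IsAtom a} has cardinality at most 2. -/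
/-- `A` is zero-projective in HA: projectivity with respect to surjections `g`
with `g⁻¹(⊥) = {⊥}`. -/
def HeytingZeroProjective (A : Type) [HeytingAlgebra A] : Prop :=
  ∀ (B C : Type) [HeytingAlgebra B] [HeytingAlgebra C],
    ∀ (h : HeytingHom A C) (g : HeytingHom B C), Function.Surjective g →
      (∀ b : B, g b = ⊥ → b = ⊥) →
      ∃ f : HeytingHom A B, ∀ a : A, g (f a) = h a

/-- The algebra `A` with one new point glued below the up-set `u`. -/
@[ext] structure GluePt {A : Type} [HeytingAlgebra A] (u : A) : Type where
  fst : A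
  snd : Prop
  cond : snd → u ≤ fst

instance GluePt.heyting {A : Type} [HeytingAlgebra A] (u : A) :
    HeytingAlgebra (GluePt u) where
  le x y := x.fst ≤ y.fst ∧ (x.snd → y.snd)
  le_refl x := ⟨le_rfl, id⟩
  le_trans x y z h k := ⟨h.1.trans k.1, k.2 ∘ h.2⟩
  le_antisymm x y h k := GluePt.ext (le_antisymm h.1 k.1) (propext ⟨h.2, k.2⟩)
  sup x y := ⟨x.fst ⊔ y.fst, x.snd ∨ y.snd, fun h => h.elim
    (fun h => (x.cond h).trans le_sup_left) (fun h => (y.cond h).trans le_sup_right)⟩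
  le_sup_left x y := ⟨le_sup_left, Or.inl⟩
  le_sup_right x y := ⟨le_sup_right, Or.inr⟩
  sup_le x y z h k := ⟨sup_le h.1 k.1, fun t => t.elim h.2 k.2⟩
  inf x y := ⟨x.fst ⊓ y.fst, x.snd ∧ y.snd, fun h => le_inf (x.cond h.1) (y.cond h.2)⟩
  inf_le_left x y := ⟨inf_le_left, And.left⟩
  inf_le_right x y := ⟨inf_le_right, And.right⟩
  le_inf x y z h k := ⟨le_inf h.1 k.1, fun t => ⟨h.2 t, k.2 t⟩⟩
  top := ⟨⊤, True, fun _ => le_top⟩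
  le_top x := ⟨le_top, fun _ => trivial⟩
  bot := ⟨⊥, False, False.elim⟩
  bot_le x := ⟨bot_le, False.elim⟩
  himp x y := ⟨x.fst ⇨ y.fst, (x.snd → y.snd) ∧ u ≤ x.fst ⇨ y.fst, And.right⟩
  le_himp_iff x y z := by
    constructor
    · rintro ⟨h, k⟩
      exact ⟨le_himp_iff.1 h, fun t => (k t.1).1 t.2⟩
    · rintro ⟨h, k⟩
      exact ⟨le_himp_iff.2 h, fun t => ⟨fun s => k ⟨t, s⟩, (x.cond t).trans (le_himp_iff.2 h)⟩⟩
  compl x := ⟨x.fst ⇨ ⊥, (x.snd → False) ∧ u ≤ x.fst ⇨ ⊥, And.right⟩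
  himp_bot x := rfl

/-- The projection forgetting the new point. -/
def GluePt.proj {A : Type} [HeytingAlgebra A] (u : A) : HeytingHom (GluePt u) A where
  toFun x := x.fst
  map_sup' _ _ := rfl
  map_inf' _ _ := rfl
  map_bot' := rfl
  map_himp' _ _ := rfl

lemma exists_cover_prime {A : Type} [HeytingAlgebra A] [Finite A]
    (hzp : HeytingZeroProjective A) (u : A) (hu : u ≠ ⊥) :
    ∃ p : A, SupPrime p ∧ u ≤ p ∧ ∀ a, a < p → a ≤ u := by
  obtain ⟨f, hf⟩ := hzp (GluePt u) A (HeytingHom.id A) (GluePt.proj u)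
    (fun a => ⟨⟨a, False, False.elim⟩, rfl⟩)
    (by
      intro b hb
      change b.fst = ⊥ at hb
      refine GluePt.ext hb (propext ⟨fun h => ?_, False.elim⟩)
      exact hu (le_bot_iff.1 (hb ▸ b.cond h)))
  have hf1 : ∀ a, (f a).fst = a := hf
  have hsup : ∀ a b, (f (a ⊔ b)).snd ↔ (f a).snd ∨ (f b).snd := fun a b => by
    rw [map_sup]; exact Iff.rfl
  have hinf : ∀ a b, (f (a ⊓ b)).snd ↔ (f a).snd ∧ (f b).snd := fun a b => by
    rw [map_inf]; exact Iff.rfl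
  have hbot : ¬ (f ⊥).snd := by rw [map_bot]; exact id
  have htop : (f ⊤).snd := by rw [map_top]; exact trivial
  have himp : ∀ a b, (f (a ⇨ b)).snd ↔ ((f a).snd → (f b).snd) ∧ u ≤ a ⇨ b := fun a b => by
    rw [map_himp]
    have : (f a ⇨ f b).snd ↔ ((f a).snd → (f b).snd) ∧ u ≤ (f a).fst ⇨ (f b).fst := Iff.rfl
    rwa [hf1, hf1] at this
  obtain ⟨p, hp, hmin⟩ := wellFounded_lt.has_min {a : A | (f a).snd} ⟨⊤, htop⟩
  have hle : ∀ a, (f a).snd → p ≤ a := fun a ha => by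
    by_contra hn
    exact hmin (p ⊓ a) ((hinf p a).2 ⟨hp, ha⟩) (inf_lt_left.2 hn)
  have hup : ∀ a, p ≤ a → (f a).snd := fun a ha => by
    rw [← sup_eq_right.2 ha]; exact (hsup p a).2 (Or.inl hp)
  refine ⟨p, ⟨?_, ?_⟩, ?_, ?_⟩
  · intro h
    rw [isMin_iff_eq_bot] at h
    exact hbot (h ▸ hp)
  · intro a b h
    exact ((hsup a b).1 (hup _ h)).imp (hle _) (hle _)
  · have := (f p).cond hp
    rwa [hf1] at this
  · intro a ha
    have h1 := hle _ ((himp a u).2 ⟨fun h => absurd (hle a h) ha.not_ge, le_himp_iff.2 inf_le_left⟩)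
    have h2 := le_himp_iff.1 h1
    rwa [inf_eq_right.2 ha.le] at h2

lemma cover_not_le {A : Type} [HeytingAlgebra A] {a b c p q : A}
    (ha : SupPrime a) (hc : SupPrime c) (hab : ¬ a ≤ b) (hac : ¬ a ≤ c)
    (hca : ¬ c ≤ a) (hcb : ¬ c ≤ b)
    (hp : a ⊔ b ≤ p) (hp' : ∀ x, x < p → x ≤ a ⊔ b)
    (hq : b ⊔ c ≤ q) (hq' : ∀ x, x < q → x ≤ b ⊔ c) : ¬ p ≤ q := by
  intro h
  rcases h.eq_or_lt with rfl | h
  · have hcp : c < p := lt_of_le_of_ne (le_sup_right.trans hq) (by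
      rintro rfl
      exact hac (le_sup_left.trans hp))
    exact (hc.2 (hp' c hcp)).elim hca hcb
  · exact (ha.2 ((le_sup_left.trans hp).trans (hq' p h))).elim hab hac

lemma no_triple {A : Type} [HeytingAlgebra A] [Finite A]
    (hzp : HeytingZeroProjective A) (a : A) : ∀ b c : A,
    SupPrime a → SupPrime b → SupPrime c →
    ¬ a ≤ b → ¬ b ≤ a → ¬ a ≤ c → ¬ c ≤ a → ¬ b ≤ c → ¬ c ≤ b → False := by
  induction a using WellFoundedGT.induction with
  | ind a ih =>
  intro b c ha hb hc ab ba ac ca bc cb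
  have ne : ∀ x y : A, SupPrime x → x ⊔ y ≠ ⊥ := fun x y hx h =>
    hx.1 (isMin_iff_eq_bot.2 (le_bot_iff.1 (h ▸ le_sup_left)))
  obtain ⟨p, pp, hp, hp'⟩ := exists_cover_prime hzp (a ⊔ b) (ne _ _ ha)
  obtain ⟨q, pq, hq, hq'⟩ := exists_cover_prime hzp (b ⊔ c) (ne _ _ hb)
  obtain ⟨r, pr, hr, hr'⟩ := exists_cover_prime hzp (c ⊔ a) (ne _ _ hc)
  have hlt : a < p := lt_of_le_of_ne (le_sup_left.trans hp) (by
    rintro rfl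
    exact ba (le_sup_right.trans hp))
  have hps := hp
  have hqs := hq
  have hrs := hr
  have hps' := hp'
  have hqs' := hq'
  have hrs' := hr'
  rw [sup_comm] at hps hqs hrs
  simp only [sup_comm a b] at hps'
  simp only [sup_comm b c] at hqs'
  simp only [sup_comm c a] at hrs'
  exact ih p hlt q r pp pq pr
    (cover_not_le ha hc ab ac ca cb hp hp' hq hq')
    (cover_not_le hc ha cb ca ac ab hqs hqs' hps hps')
    (cover_not_le hb hc ba bc cb ca hps hps' hrs hrs')
    (cover_not_le hc hb ca cb bc ba hr hr' hp hp')
    (cover_not_le hb ha bc ba ab ac hq hq' hr hr')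
    (cover_not_le ha hb ac ab ba bc hrs hrs' hqs hqs')

lemma atom_supPrime {A : Type} [HeytingAlgebra A] {a : A} (ha : IsAtom a) : SupPrime a := by
  refine ⟨fun h => ha.1 (isMin_iff_eq_bot.1 h), fun x y h => ?_⟩
  by_contra! hn
  have hx := disjoint_iff.2 (ha.2 (a ⊓ x) (inf_lt_left.2 hn.1))
  have hy := disjoint_iff.2 (ha.2 (a ⊓ y) (inf_lt_left.2 hn.2))
  exact ha.1 (disjoint_self.1 ((disjoint_sup_right.2 ⟨hx, hy⟩).mono_right h))

/-- A finite zero-projective Heyting algebra has at most two atoms. -/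
theorem finite_zero_projective_at_most_two_atoms (A : Type)
    [HeytingAlgebra A] [Finite A] (hzp : HeytingZeroProjective A) :
    {a : A | IsAtom a}.ncard ≤ 2 := by
  by_contra! h
  obtain ⟨a, b, c, ha, hb, hc, ab, ac, bc⟩ := (Set.two_lt_ncard_iff (Set.toFinite _)).1 h
  have key : ∀ x y : A, IsAtom x → IsAtom y → x ≠ y → ¬ x ≤ y := fun x y hx hy hn hle =>
    (hy.le_iff.1 hle).elim hx.1 hn
  exact no_triple hzp a b c (atom_supPrime ha) (atom_supPrime hb) (atom_supPrime hc)
    (key _ _ ha hb ab) (key _ _ hb ha ab.symm) (key _ _ ha hc ac) (key _ _ hc ha ac.symm)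
    (key _ _ hb hc bc) (key _ _ hc hb bc.symm)
end

section
/- Let A be a finite Heyting algebra for which there exist n ≥ 1 and elements ⊥ = c_0 < c_1 < ⋯ < c_n = ⊤ of A, each of which is a node of A, such that: every element of A lies in the closed interval [c_i, c_{i+1}] for some i < n; for each i < n, the interval [c_i, c_{i+1}] either has exactly two elements, or has exactly four elements and its two elements distinct from c_i and c_{i+1} are incomparable; and the top interval [c_{n-1}, c_n] has exactly two elements. Then A is projective in HA. -/
/-- A decomposition of a Heyting algebra by a chain of nodes
`⊥ = c 0 < c 1 < ⋯ < c n = ⊤`, where each interval `[c i, c (i+1)]` is a copy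
of `2` or of `4` (the latter with two incomparable middle elements), every
element lies in some such interval, and the topmost interval is a copy of `2`. -/
def NodeChain (A : Type) [HeytingAlgebra A] (n : ℕ) (c : ℕ → A) : Prop :=
  c 0 = ⊥ ∧ c n = ⊤ ∧
  (∀ i < n, c i < c (i + 1)) ∧
  (∀ i ≤ n, ∀ b : A, b ≤ c i ∨ c i ≤ b) ∧
  (∀ a : A, ∃ i < n, a ∈ Set.Icc (c i) (c (i + 1))) ∧
  (∀ i < n,
    (Set.Icc (c i) (c (i + 1))).ncard = 2 ∨
      ((Set.Icc (c i) (c (i + 1))).ncard = 4 ∧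
        ∀ x ∈ Set.Icc (c i) (c (i + 1)), ∀ y ∈ Set.Icc (c i) (c (i + 1)),
          x ≠ c i → x ≠ c (i + 1) → y ≠ c i → y ≠ c (i + 1) → x ≠ y →
            ¬x ≤ y ∧ ¬y ≤ x)) ∧
  (Set.Icc (c (n - 1)) (c n)).ncard = 2

/-- `f` is a partial lift defined on the elements below `c`. -/
structure GoodLift {A B C : Type} [HeytingAlgebra A] [HeytingAlgebra B] [HeytingAlgebra C]
    (h : HeytingHom A C) (g : HeytingHom B C) (c : A) (f : A → B) : Prop where
  bot : f ⊥ = ⊥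
  lift : ∀ a ≤ c, g (f a) = h a
  inf : ∀ a ≤ c, ∀ b ≤ c, f (a ⊓ b) = f a ⊓ f b
  sup : ∀ a ≤ c, ∀ b ≤ c, f (a ⊔ b) = f a ⊔ f b
  imp : ∀ a ≤ c, ∀ b ≤ c, ¬ a ≤ b → f (a ⇨ b) = f a ⇨ f b

/-- `k` is a lift on the interval `[c, d]`. -/
structure GoodBlock {A B C : Type} [HeytingAlgebra A] [HeytingAlgebra B] [HeytingAlgebra C]
    (h : HeytingHom A C) (g : HeytingHom B C) (c d : A) (k : A → B) : Prop where
  lift : ∀ a, c ≤ a → a ≤ d → g (k a) = h a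
  inf : ∀ a, c ≤ a → a ≤ d → ∀ b, c ≤ b → b ≤ d → k (a ⊓ b) = k a ⊓ k b
  sup : ∀ a, c ≤ a → a ≤ d → ∀ b, c ≤ b → b ≤ d → k (a ⊔ b) = k a ⊔ k b
  imp : ∀ a, c ≤ a → a ≤ d → ∀ b, c ≤ b → b ≤ d → ¬ a ≤ b → k (a ⇨ b) = k a ⇨ k b

/-- If `d` is a node above `a` and `a` is not below `b`, then `a ⇨ b ≤ d`. -/
theorem himp_le_of_isNode {A : Type} [HeytingAlgebra A] {a b d : A}
    (hd : ∀ z : A, z ≤ d ∨ d ≤ z) (had : a ≤ d) (hab : ¬ a ≤ b) : a ⇨ b ≤ d := by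
  rcases hd (a ⇨ b) with h | h
  · exact h
  · exact absurd (by simpa using le_himp_iff.1 (had.trans h)) hab

/-- If `c` is a node, `b ≤ c ≤ a` and `c` is not below `b`, then `a ⇨ b = b`. -/
theorem himp_eq_of_isNode {A : Type} [HeytingAlgebra A] {a b c : A}
    (hc : ∀ z : A, z ≤ c ∨ c ≤ z) (hca : c ≤ a) (hcb : ¬ c ≤ b) : a ⇨ b = b := by
  apply le_antisymm _ le_himp
  have h1 : a ⇨ b ≤ c ⇨ b := himp_le_himp_right hca
  have h2 : c ⇨ b ≤ c := himp_le_of_isNode hc le_rfl hcb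
  have h3 : (c ⇨ b) ⊓ c ≤ b := himp_inf_le
  rw [inf_eq_left.2 h2] at h3
  exact h1.trans h3

theorem GoodLift.mono {A B C : Type} [HeytingAlgebra A] [HeytingAlgebra B] [HeytingAlgebra C]
    {h : HeytingHom A C} {g : HeytingHom B C} {c : A} {f : A → B} (hf : GoodLift h g c f)
    {a b : A} (hb : b ≤ c) (hab : a ≤ b) : f a ≤ f b := by
  have := hf.inf a (hab.trans hb) b hb
  rw [inf_eq_left.2 hab] at this
  rw [this]; exact inf_le_right

theorem GoodLift.extend {A B C : Type} [HeytingAlgebra A] [HeytingAlgebra B] [HeytingAlgebra C]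
    {h : HeytingHom A C} {g : HeytingHom B C} {c d : A} {f k : A → B}
    (hf : GoodLift h g c f) (hk : GoodBlock h g c d k) (hkc : k c = f c)
    (hc : ∀ z : A, z ≤ c ∨ c ≤ z) (hcd : c ≤ d) :
    ∃ f' : A → B, GoodLift h g d f' ∧ f' d = k d := by
  classical
  obtain ⟨f', h1, h2⟩ : ∃ f' : A → B, (∀ a, a ≤ c → f' a = f a) ∧ (∀ a, c ≤ a → f' a = k a) := by
    refine ⟨fun a => if a ≤ c then f a else k a, fun a ha => if_pos ha, fun a ha => ?_⟩
    by_cases h : a ≤ c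
    · obtain rfl : a = c := le_antisymm h ha
      simp [hkc]
    · simp [h]
  have kmono : ∀ a, c ≤ a → a ≤ d → f c ≤ k a := by
    intro a ha had
    have := hk.inf c le_rfl hcd a ha had
    rw [inf_eq_left.2 ha, hkc] at this
    rw [this]; exact inf_le_right
  have mix : ∀ a b, a ≤ c → c ≤ b → b ≤ d → f a ≤ k b := fun a b ha hb hbd =>
    (hf.mono le_rfl ha).trans (kmono b hb hbd)
  refine ⟨f', ⟨?_, ?_, ?_, ?_, ?_⟩, h2 d hcd⟩
  · rw [h1 _ bot_le, hf.bot]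
  · intro a ha
    rcases hc a with hac | hac
    · rw [h1 _ hac, hf.lift a hac]
    · rw [h2 _ hac, hk.lift a hac ha]
  · intro a ha b hb
    rcases hc a with hac | hac <;> rcases hc b with hbc | hbc
    · rw [h1 _ hac, h1 _ hbc, h1 _ (inf_le_left.trans hac), hf.inf a hac b hbc]
    · rw [inf_eq_left.2 (hac.trans hbc), h1 _ hac, h2 _ hbc, inf_eq_left.2 (mix a b hac hbc hb)]
    · rw [inf_eq_right.2 (hbc.trans hac), h1 _ hbc, h2 _ hac, inf_eq_right.2 (mix b a hbc hac ha)]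
    · rw [h2 _ hac, h2 _ hbc, h2 _ (le_inf hac hbc), hk.inf a hac ha b hbc hb]
  · intro a ha b hb
    rcases hc a with hac | hac <;> rcases hc b with hbc | hbc
    · rw [h1 _ hac, h1 _ hbc, h1 _ (sup_le hac hbc), hf.sup a hac b hbc]
    · rw [sup_eq_right.2 (hac.trans hbc), h1 _ hac, h2 _ hbc, sup_eq_right.2 (mix a b hac hbc hb)]
    · rw [sup_eq_left.2 (hbc.trans hac), h1 _ hbc, h2 _ hac, sup_eq_left.2 (mix b a hbc hac ha)]
    · rw [h2 _ hac, h2 _ hbc, h2 _ (hac.trans le_sup_left), hk.sup a hac ha b hbc hb]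
  · intro a ha b hb hab
    rcases hc b with hbc | hbc
    · rcases hc a with hac | hac
      · rw [h1 _ hac, h1 _ hbc, h1 _ (himp_le_of_isNode hc hac hab), hf.imp a hac b hbc hab]
      · by_cases hcb : c ≤ b
        · rw [h2 _ hac, h2 _ hcb, h2 _ (hcb.trans le_himp), hk.imp a hac ha b hcb hb hab]
        · rw [himp_eq_of_isNode hc hac hcb, h1 _ hbc, h2 _ hac]
          apply le_antisymm le_himp
          have e := hf.imp c le_rfl b hbc hcb
          rw [himp_eq_of_isNode hc le_rfl hcb] at e
          exact (himp_le_himp_right (kmono a hac ha)).trans e.ge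
    · have hac : c ≤ a := (hc a).resolve_left fun hac => hab (hac.trans hbc)
      rw [h2 _ hac, h2 _ hbc, h2 _ (hbc.trans le_himp), hk.imp a hac ha b hbc hb hab]

theorem block_two {A B C : Type} [HeytingAlgebra A] [HeytingAlgebra B] [HeytingAlgebra C]
    {h : HeytingHom A C} {g : HeytingHom B C} {c d : A} (hcd : c < d)
    (hd : ∀ z : A, z ≤ d ∨ d ≤ z)
    (hall : ∀ a, c ≤ a → a ≤ d → a = c ∨ a = d) {e u : B} (hge : g e = h c) (hgu : g u = h d)
    (heu : e ≤ u) (hue : u ⇨ e = e) :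
    ∃ k : A → B, GoodBlock h g c d k ∧ k c = e ∧ k d = u := by
  classical
  obtain ⟨k, kc, kd⟩ : ∃ k : A → B, k c = e ∧ k d = u :=
    ⟨fun a => if a = c then e else u, by simp, by simp [hcd.ne']⟩
  have hdc : d ⇨ c = c := himp_eq_of_isNode hd le_rfl hcd.not_ge
  refine ⟨k, ⟨?_, ?_, ?_, ?_⟩, kc, kd⟩
  · intro a h1 h2
    rcases hall a h1 h2 with rfl | rfl <;> simp [*]
  · intro a h1 h2 b h3 h4
    rcases hall a h1 h2 with rfl | rfl <;> rcases hall b h3 h4 with rfl | rfl <;> simp [*]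
  · intro a h1 h2 b h3 h4
    rcases hall a h1 h2 with rfl | rfl <;> rcases hall b h3 h4 with rfl | rfl <;> simp [*]
  · intro a h1 h2 b h3 h4 hab
    rcases hall a h1 h2 with rfl | rfl <;> rcases hall b h3 h4 with rfl | rfl
    · exact absurd le_rfl hab
    · exact absurd h3 hab
    · rw [hdc, kc, kd, hue]
    · exact absurd le_rfl hab

theorem block_four {A B C : Type} [HeytingAlgebra A] [HeytingAlgebra B] [HeytingAlgebra C]
    {h : HeytingHom A C} {g : HeytingHom B C} {c d x y : A} (hcd : c < d)
    (hd : ∀ z : A, z ≤ d ∨ d ≤ z) (hcx : c < x) (hxd : x < d) (hcy : c < y) (hyd : y < d)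
    (hxy : ¬ x ≤ y) (hyx : ¬ y ≤ x)
    (hall : ∀ a, c ≤ a → a ≤ d → a = c ∨ a = x ∨ a = y ∨ a = d)
    (hg : Function.Surjective g) {e : B} (hge : g e = h c) :
    ∃ k : A → B, GoodBlock h g c d k ∧ k c = e := by
  classical
  have ixy : x ⊓ y = c := by
    rcases hall (x ⊓ y) (le_inf hcx.le hcy.le) (inf_le_left.trans hxd.le) with h | h | h | h
    · exact h
    · exact absurd (inf_eq_left.1 h) hxy
    · exact absurd (inf_eq_right.1 h) hyx
    · exact absurd (h.ge.trans inf_le_left) hxd.not_ge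
  have sxy : x ⊔ y = d := by
    rcases hall (x ⊔ y) (hcx.le.trans le_sup_left) (sup_le hxd.le hyd.le) with h | h | h | h
    · exact absurd (le_sup_left.trans h.le) hcx.not_ge
    · exact absurd (sup_eq_left.1 h) hyx
    · exact absurd (sup_eq_right.1 h) hxy
    · exact h
  have iyx : y ⊓ x = c := by rw [inf_comm, ixy]
  have syx : y ⊔ x = d := by rw [sup_comm, sxy]
  have key : ∀ x y : A, c < x → x < d → c < y → y < d → ¬ x ≤ y → x ⊓ y = c →
      (∀ a, c ≤ a → a ≤ d → a = c ∨ a = x ∨ a = y ∨ a = d) → x ⇨ c = y := by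
    intro x y hcx hxd hcy hyd hxy ixy hall
    have hle : y ≤ x ⇨ c := by rw [le_himp_iff, inf_comm, ixy]
    have hm : (x ⇨ c) ⊓ x ≤ c := himp_inf_le
    rcases hall (x ⇨ c) le_himp (himp_le_of_isNode hd hxd.le hcx.not_ge) with h | h | h | h
    · exact absurd (hle.trans h.le) hcy.not_ge
    · rw [h, inf_idem] at hm; exact absurd hm hcx.not_ge
    · exact h
    · rw [h, inf_eq_right.2 hxd.le] at hm; exact absurd hm hcx.not_ge
  have xc : x ⇨ c = y := key x y hcx hxd hcy hyd hxy ixy hall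
  have yc : y ⇨ c = x := key y x hcy hyd hcx hxd hyx iyx (fun a h1 h2 => by
    have := hall a h1 h2; tauto)
  have xy : x ⇨ y = y := by rw [← xc, himp_himp, inf_idem]
  have yx : y ⇨ x = x := by rw [← yc, himp_himp, inf_idem]
  have dc : d ⇨ c = c := himp_eq_of_isNode hd le_rfl hcd.not_ge
  have dx : d ⇨ x = x := himp_eq_of_isNode hd le_rfl hxd.not_ge
  have dy : d ⇨ y = y := himp_eq_of_isNode hd le_rfl hyd.not_ge
  obtain ⟨b, hb⟩ := hg (h x)
  obtain ⟨p, q, u, hp, hq, hu, pq, gp, gq⟩ : ∃ p q u : B, p ⇨ e = q ∧ q ⇨ e = p ∧ u = p ⊔ q ∧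
      p ⊓ q = e ∧ g p = h x ∧ g q = h y := by
    refine ⟨(b ⇨ e) ⇨ e, b ⇨ e, _, ?_, rfl, rfl, ?_, ?_, ?_⟩
    · apply le_antisymm
      · exact himp_le_himp_right le_himp_himp
      · exact le_himp_himp
    · apply le_antisymm himp_inf_le (le_inf le_himp le_himp)
    · rw [map_himp, map_himp, hb, hge, ← map_himp, ← map_himp, xc, yc]
    · rw [map_himp, hb, hge, ← map_himp, xc]
  have hep : e ≤ p := pq ▸ inf_le_left
  have heq : e ≤ q := pq ▸ inf_le_right
  have qp : q ⊓ p = e := by rw [inf_comm, pq]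
  have gu : g u = h d := by rw [hu, map_sup, gp, gq, ← map_sup, sxy]
  have hpq : p ⇨ q = q := by rw [← hp, himp_himp, inf_idem]
  have hqp : q ⇨ p = p := by rw [← hq, himp_himp, inf_idem]
  have hpu : p ≤ u := hu ▸ le_sup_left
  have hqu : q ≤ u := hu ▸ le_sup_right
  have heu : e ≤ u := hep.trans hpu
  have ue : u ⇨ e = e := by rw [hu, sup_himp_distrib, hp, hq, qp]
  have up : u ⇨ p = p := by rw [hu, sup_himp_distrib, himp_self, top_inf_eq, hqp]
  have uq : u ⇨ q = q := by rw [hu, sup_himp_distrib, himp_self, inf_top_eq, hpq]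
  have spq : p ⊔ q = u := hu.symm
  have sqp : q ⊔ p = u := by rw [sup_comm, spq]
  obtain ⟨k, kc, kx, ky, kd⟩ : ∃ k : A → B, k c = e ∧ k x = p ∧ k y = q ∧ k d = u := by
    refine ⟨fun a => if a = c then e else if a = x then p else if a = y then q else u,
      ?_, ?_, ?_, ?_⟩
    · simp
    · simp [hcx.ne']
    · have : y ≠ x := fun h => hyx h.le
      simp [hcy.ne', this]
    · simp [hcd.ne', hxd.ne', hyd.ne']
  clear hu
  refine ⟨k, ⟨?_, ?_, ?_, ?_⟩, kc⟩
  · intro a h1 h2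
    rcases hall a h1 h2 with h | h | h | h <;> subst a <;> simp [*]
  · intro a h1 h2 b h3 h4
    rcases hall a h1 h2 with h | h | h | h <;> rcases hall b h3 h4 with h' | h' | h' | h' <;>
      subst a <;> subst b <;> simp [*, le_of_lt]
  · intro a h1 h2 b h3 h4
    rcases hall a h1 h2 with h | h | h | h <;> rcases hall b h3 h4 with h' | h' | h' | h' <;>
      subst a <;> subst b <;> simp [*, le_of_lt]
  · intro a h1 h2 b h3 h4 hab
    rcases hall a h1 h2 with h | h | h | h <;> rcases hall b h3 h4 with h' | h' | h' | h' <;>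
      subst a <;> subst b <;> first | exact absurd le_rfl hab | exact absurd (by assumption) hab | exact absurd (le_of_lt (by assumption)) hab | simp only [*]

/-- A finite Heyting algebra that is an ordinal sum of copies of `2` and `4`
with topmost summand `2` is projective in HA. -/
theorem node_chain_implies_projective_Heyting (A : Type) [HeytingAlgebra A]
    [Finite A] (n : ℕ) (hn : n ≥ 1) (c : ℕ → A) (hc : NodeChain A n c) :
    HeytingProjective A := by
  classical
  intro B C _ _ h g hg
  obtain ⟨h0, hn', hlt, hnode, -, hblk, htop⟩ := hc
  have main : ∀ i ≤ n, ∃ f : A → B, GoodLift h g (c i) f ∧ (i = n → f (c i) = ⊤) := by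
    intro i
    induction i with
    | zero =>
      intro _
      refine ⟨fun _ => ⊥, ⟨rfl, ?_, ?_, ?_, ?_⟩, fun hi => by omega⟩
      · intro a ha
        rw [h0, le_bot_iff] at ha
        simp [ha]
      · simp
      · simp
      · intro a ha b hb hab
        rw [h0, le_bot_iff] at ha
        exact absurd (ha ▸ bot_le) hab
    | succ i ih =>
      intro hi
      obtain ⟨f, hf, -⟩ := ih (by omega)
      have hcd := hlt i (by omega)
      have hnc := hnode i (by omega)
      have hnd := hnode (i + 1) hi
      have hge : g (f (c i)) = h (c i) := hf.lift _ le_rfl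
      generalize hC : c i = x at *
      generalize hD : c (i + 1) = y at *
      have hx : x ∈ Set.Icc x y := ⟨le_rfl, hcd.le⟩
      have hy : y ∈ Set.Icc x y := ⟨hcd.le, le_rfl⟩
      have two : (Set.Icc x y).ncard = 2 →
          ∃ f : A → B, GoodLift h g y f ∧ (i + 1 = n → f y = ⊤) := by
        intro hcard
        have hall : ∀ a, x ≤ a → a ≤ y → a = x ∨ a = y := by
          intro a h1 h2
          have hsub : ({x, y} : Set A) = Set.Icc x y := by
            apply Set.eq_of_subset_of_ncard_le _ _ (Set.toFinite _)
            · rintro z (rfl | rfl) <;> assumption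
            · rw [hcard, Set.ncard_pair hcd.ne]
          have : a ∈ ({x, y} : Set A) := hsub ▸ ⟨h1, h2⟩
          simpa using this
        obtain ⟨u, gu, hu1, hu2, hu3⟩ : ∃ u : B, g u = h y ∧ f x ≤ u ∧ u ⇨ f x = f x ∧
            (i + 1 = n → u = ⊤) := by
          by_cases hin : i + 1 = n
          · refine ⟨⊤, ?_, le_top, top_himp, fun _ => rfl⟩
            rw [← hD, hin, hn', map_top, map_top]
          · obtain ⟨b, hb⟩ := hg (h y)
            refine ⟨b ⊔ (b ⇨ f x), ?_, le_himp.trans le_sup_right, ?_, fun h => absurd h hin⟩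
            · rw [map_sup, map_himp, hb, hge, ← map_himp,
                himp_eq_of_isNode hnd le_rfl hcd.not_ge, ← map_sup, sup_eq_left.2 hcd.le]
            · apply le_antisymm _ le_himp
              rw [sup_himp_distrib, inf_comm]
              exact himp_inf_le
        obtain ⟨k, hk, kx, ky⟩ := block_two hcd hnd hall hge gu hu1 hu2
        obtain ⟨f', hf', e⟩ := hf.extend hk kx hnc hcd.le
        exact ⟨f', hf', fun hin => by rw [e, ky, hu3 hin]⟩
      by_cases hin : i + 1 = n
      · apply two
        have : n - 1 = i := by omega
        rwa [this, ← hin, hC, hD] at htop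
      have hI := hblk i (by omega)
      rw [hC, hD] at hI
      rcases hI with hI | ⟨hcard, hinc⟩
      · exact two hI
      have hdiff : (Set.Icc x y \ {x, y}).ncard = 2 := by
        rw [Set.ncard_sdiff, hcard, Set.ncard_pair hcd.ne]
        rintro z (rfl | rfl) <;> assumption
      obtain ⟨p, q, hpq, hset⟩ := Set.ncard_eq_two.1 hdiff
      have hp : p ∈ Set.Icc x y \ {x, y} := by rw [hset]; simp
      have hq : q ∈ Set.Icc x y \ {x, y} := by rw [hset]; simp
      have hall : ∀ a, x ≤ a → a ≤ y → a = x ∨ a = p ∨ a = q ∨ a = y := by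
        intro a h1 h2
        by_cases hax : a = x
        · exact Or.inl hax
        by_cases hay : a = y
        · simp [hay]
        have : a ∈ Set.Icc x y \ {x, y} := ⟨⟨h1, h2⟩, by simp [hax, hay]⟩
        rw [hset] at this
        simp only [Set.mem_insert_iff, Set.mem_singleton_iff] at this
        tauto
      simp only [Set.mem_sdiff, Set.mem_insert_iff, Set.mem_singleton_iff, not_or] at hp hq
      obtain ⟨hp1, hp2, hp3⟩ := hp
      obtain ⟨hq1, hq2, hq3⟩ := hq
      have hi := hinc p hp1 q hq1 hp2 hp3 hq2 hq3 hpq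
      obtain ⟨k, hk, kx⟩ := block_four hcd hnd (lt_of_le_of_ne hp1.1 (Ne.symm hp2))
        (lt_of_le_of_ne hp1.2 hp3) (lt_of_le_of_ne hq1.1 (Ne.symm hq2))
        (lt_of_le_of_ne hq1.2 hq3) hi.1 hi.2 hall hg hge
      obtain ⟨f', hf', -⟩ := hf.extend hk kx hnc hcd.le
      exact ⟨f', hf', fun h => absurd h hin⟩
  obtain ⟨f, hf, htp⟩ := main n le_rfl
  have htp := htp rfl
  rw [hn'] at hf htp
  refine ⟨{ toFun := f, map_sup' := fun a b => hf.sup a le_top b le_top,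
            map_inf' := fun a b => hf.inf a le_top b le_top, map_bot' := hf.bot,
            map_himp' := fun a b => ?_ }, fun a => hf.lift a le_top⟩
  by_cases hab : a ≤ b
  · rw [himp_eq_top_iff.2 hab, htp, eq_comm, himp_eq_top_iff]
    exact hf.mono le_top hab
  · exact hf.imp a le_top b le_top hab
end

section
/- Let A be a hoop and u ∈ A with u·u = u. Then for all a, b ∈ A: u → (a → b) = (u → a) → (u → b), and u → (a·b) = (u → a)·(u → b). -/
/-- A hoop: a commutative monoid `(α, ·, 1)` with an operation `→` satisfying
`x → x = 1`, divisibility `x·(x → y) = y·(y → x)`, and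
`x → (y → z) = (x·y) → z`. -/
class Hoop (α : Type) where
  mul : α → α → α
  himp : α → α → α
  one : α
  mul_comm : ∀ a b : α, mul a b = mul b a
  mul_assoc : ∀ a b c : α, mul (mul a b) c = mul a (mul b c)
  mul_one : ∀ a : α, mul a one = a
  himp_self : ∀ a : α, himp a a = one
  div : ∀ a b : α, mul a (himp a b) = mul b (himp b a)
  himp_himp : ∀ a b c : α, himp a (himp b c) = himp (mul a b) c

namespace HoopAux
open Hoop
variable {A : Type} [Hoop A]

/-- The hoop order. -/
def le (x y : A) : Prop := himp x y = one

theorem hp_one_mul (x : A) : mul one x = x := by rw [Hoop.mul_comm, Hoop.mul_one]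

theorem one_himp (x : A) : himp one x = x := by
  have h3 : himp (himp one x) x = one := by
    have h4 := Hoop.himp_himp (himp one x) one x
    rw [Hoop.mul_one, Hoop.himp_self] at h4
    exact h4.symm
  have h5 : himp x (himp one x) = one := by rw [Hoop.himp_himp, Hoop.mul_one, Hoop.himp_self]
  have h := div x (himp one x)
  rw [h5, h3, Hoop.mul_one, Hoop.mul_one] at h
  exact h.symm

theorem himp_one (x : A) : himp x one = one := by
  have h1 : mul x (himp x one) = x := by rw [div, hp_one_mul, one_himp]
  have h := Hoop.himp_himp (himp x one) x one
  rw [Hoop.himp_self, Hoop.mul_comm, h1] at h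
  exact h.symm

theorem hp_le_refl (x : A) : le x x := Hoop.himp_self x

theorem hp_antisymm {x y : A} (h : le x y) (k : le y x) : x = y := by
  have := div x y
  rwa [h, k, Hoop.mul_one, Hoop.mul_one] at this

theorem hp_res {x y z : A} : le (mul x y) z ↔ le x (himp y z) := by
  unfold le; rw [Hoop.himp_himp]

theorem hp_res' {x y z : A} : le (mul x y) z ↔ le y (himp x z) := by
  rw [Hoop.mul_comm, hp_res]

theorem hp_mul_le_left (x y : A) : le (mul x y) x := by
  rw [hp_res']; unfold le; rw [Hoop.himp_self, himp_one]

theorem eq_mul {x y : A} (h : le x y) : x = mul y (himp y x) := by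
  rw [← div, h, Hoop.mul_one]

theorem hp_trans {x y z : A} (h : le x y) (k : le y z) : le x z := by
  rw [eq_mul h, Hoop.mul_comm, hp_res]
  unfold le at *; rw [k, himp_one]

theorem hp_mul_mono_left {x y : A} (z : A) (h : le x y) : le (mul x z) (mul y z) :=
  hp_res.2 (hp_trans h (hp_res.1 (hp_le_refl _)))

theorem hp_mul_mono {x y z w : A} (h : le x y) (k : le z w) : le (mul x z) (mul y w) := by
  refine hp_trans (hp_mul_mono_left z h) ?_
  rw [Hoop.mul_comm y, Hoop.mul_comm y]
  exact hp_mul_mono_left y k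

theorem hp_mp (x y : A) : le (mul x (himp x y)) y := hp_res'.2 (hp_le_refl _)

theorem himp_mono {x y : A} (z : A) (h : le x y) : le (himp z x) (himp z y) :=
  hp_res'.1 (hp_trans (hp_mp z x) h)

theorem himp_anti {x y : A} (z : A) (h : le x y) : le (himp y z) (himp x z) :=
  hp_res'.1 (hp_trans (hp_mul_mono_left _ h) (hp_mp y z))

theorem hp_le_himp (x y : A) : le y (himp x y) := hp_res.1 (hp_mul_le_left _ _)

theorem idem_meet {u : A} (hu : mul u u = u) (a : A) : mul u (himp u a) = mul u a := by
  apply hp_antisymm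
  · conv => arg 1; rw [← hu, Hoop.mul_assoc, hu]
    exact hp_mul_mono (hp_le_refl _) (hp_mp u a)
  · exact hp_mul_mono (hp_le_refl _) (hp_le_himp u a)

end HoopAux

open HoopAux in
/-- In any hoop, an idempotent element `u` satisfies
`u → (a → b) = (u → a) → (u → b)` and `u → a·b = (u → a)·(u → b)`. -/
theorem hoop_idempotent_himp_mul_distrib (A : Type) [Hoop A] (u : A)
    (hu : Hoop.mul u u = u) (a b : A) :
    Hoop.himp u (Hoop.himp a b) = Hoop.himp (Hoop.himp u a) (Hoop.himp u b) ∧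
    Hoop.himp u (Hoop.mul a b) = Hoop.mul (Hoop.himp u a) (Hoop.himp u b) := by
  refine ⟨?_, ?_⟩
  · rw [Hoop.himp_himp, Hoop.himp_himp, Hoop.mul_comm (Hoop.himp u a), idem_meet hu]
  apply hp_antisymm
  · have hea : le (Hoop.himp u (Hoop.mul a b)) (Hoop.himp u a) := himp_mono u (hp_mul_le_left a b)
    have heb : le (Hoop.himp u (Hoop.mul a b)) (Hoop.himp u b) := by
      apply himp_mono; rw [Hoop.mul_comm]; exact hp_mul_le_left b a
    have hab : le (Hoop.mul a b) (Hoop.mul (Hoop.himp u a) (Hoop.himp u b)) :=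
      hp_mul_mono (hp_le_himp u a) (hp_le_himp u b)
    have hue : Hoop.himp u (Hoop.himp u (Hoop.mul a b)) = Hoop.himp u (Hoop.mul a b) := by
      rw [Hoop.himp_himp, hu]
    have hul : le (Hoop.mul u (Hoop.himp u (Hoop.mul a b)))
        (Hoop.mul (Hoop.himp u a) (Hoop.himp u b)) := hp_trans (hp_mp _ _) hab
    have hee := hp_mul_mono hea heb
    generalize Hoop.mul (Hoop.himp u a) (Hoop.himp u b) = p at *
    generalize Hoop.himp u (Hoop.mul a b) = e at *
    have hew : le e (Hoop.himp e p) := hp_res.1 hee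
    have huw : le u (Hoop.himp e p) := hp_res.1 hul
    have hwe : le (Hoop.himp (Hoop.himp e p) e) e := by
      have := himp_anti e huw
      rwa [hue] at this
    have h1 : le e (Hoop.mul (Hoop.himp e p) e) := by
      have := hp_mul_mono (hp_le_refl (Hoop.himp e p)) hwe
      rwa [← eq_mul hew] at this
    exact hp_trans h1 (hp_res.2 (hp_le_refl _))
  · rw [← hp_res']
    have h : Hoop.mul u (Hoop.mul (Hoop.himp u a) (Hoop.himp u b)) =
        Hoop.mul (Hoop.mul u (Hoop.himp u a)) (Hoop.mul u (Hoop.himp u b)) := by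
      rw [Hoop.mul_comm u (Hoop.himp u a), Hoop.mul_assoc, ← Hoop.mul_assoc u u, hu,
        ← Hoop.mul_assoc, ← Hoop.mul_assoc, Hoop.mul_comm u]
    rw [h]
    exact hp_mul_mono (hp_mp u a) (hp_mp u b)
end

section
/- Let A and B be finite hoops and g : B → A a surjective hoop homomorphism. Then A is a retract of B: there exists a hoop homomorphism h : A → B with g ∘ h = id_A. Consequently, every finite hoop is projective in the class of all finite hoops. -/
/-- A hoop homomorphism preserves `·`, `→` and `1`. -/
def IsHoopHom {α β : Type} [Hoop α] [Hoop β] (f : α → β) : Prop :=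
  (∀ a b : α, f (Hoop.mul a b) = Hoop.mul (f a) (f b)) ∧
  (∀ a b : α, f (Hoop.himp a b) = Hoop.himp (f a) (f b)) ∧
  f Hoop.one = Hoop.one

namespace HoopAux

local infixl:70 "⊗ₕ" => Hoop.mul
local infixr:60 "⇒ₕ" => Hoop.himp

/-- The hoop order. -/
def Le {α : Type} [Hoop α] (a b : α) : Prop := a ⇒ₕ b = Hoop.one

local infix:50 "≼ₕ" => Le

section
variable {α : Type} [Hoop α]

lemma le_refl (a : α) : a ≼ₕ a := Hoop.himp_self a

lemma one_mul (a : α) : Hoop.one ⊗ₕ a = a := by rw [Hoop.mul_comm, Hoop.mul_one]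

lemma antisymm {a b : α} (h1 : a ≼ₕ b) (h2 : b ≼ₕ a) : a = b := by
  have h := Hoop.div a b
  unfold Le at h1 h2
  rwa [h1, h2, Hoop.mul_one, Hoop.mul_one] at h

lemma one_himp_s12 (a : α) : Hoop.one ⇒ₕ a = a := by
  apply antisymm
  · have h := Hoop.himp_self (Hoop.one ⇒ₕ a)
    rw [Hoop.himp_himp, Hoop.mul_one] at h
    exact h
  · unfold Le
    rw [Hoop.himp_himp, Hoop.mul_one, Hoop.himp_self]

lemma himp_one_s12 (a : α) : a ⇒ₕ Hoop.one = Hoop.one := by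
  have h := Hoop.himp_self (a ⇒ₕ Hoop.one)
  rw [Hoop.himp_himp, Hoop.mul_comm, Hoop.div, one_himp_s12, one_mul] at h
  exact h

lemma res {a b c : α} : a ⊗ₕ b ≼ₕ c ↔ a ≼ₕ b ⇒ₕ c := by
  unfold Le; rw [Hoop.himp_himp]

lemma himp_comm (a b c : α) : a ⇒ₕ (b ⇒ₕ c) = b ⇒ₕ (a ⇒ₕ c) := by
  rw [Hoop.himp_himp, Hoop.himp_himp, Hoop.mul_comm]

lemma mul_le_right (a b : α) : a ⊗ₕ b ≼ₕ b := by
  rw [res, Hoop.himp_self]; exact himp_one_s12 a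

lemma mul_le_left (a b : α) : a ⊗ₕ b ≼ₕ a := by
  rw [Hoop.mul_comm]; exact mul_le_right b a

lemma eq_of_le {a b : α} (h : a ≼ₕ b) : b ⊗ₕ (b ⇒ₕ a) = a := by
  rw [Hoop.div, h, Hoop.mul_one]

lemma trans {a b c : α} (h1 : a ≼ₕ b) (h2 : b ≼ₕ c) : a ≼ₕ c := by
  rw [← eq_of_le h1, Hoop.mul_comm, res, h2]; exact himp_one_s12 _

lemma mul_mono_right (c : α) {a b : α} (h : a ≼ₕ b) : c ⊗ₕ a ≼ₕ c ⊗ₕ b := by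
  rw [← eq_of_le h, ← Hoop.mul_assoc]; exact mul_le_left _ _

lemma mul_mono_left (c : α) {a b : α} (h : a ≼ₕ b) : a ⊗ₕ c ≼ₕ b ⊗ₕ c := by
  rw [Hoop.mul_comm a, Hoop.mul_comm b]; exact mul_mono_right c h

lemma mp (a b : α) : a ⊗ₕ (a ⇒ₕ b) ≼ₕ b := by
  rw [Hoop.div]; exact mul_le_left _ _

lemma himp_mono_s12 (c : α) {a b : α} (h : a ≼ₕ b) : c ⇒ₕ a ≼ₕ c ⇒ₕ b := by
  rw [← res, Hoop.mul_comm]; exact trans (mp _ _) h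

lemma himp_anti_s12 (c : α) {a b : α} (h : a ≼ₕ b) : b ⇒ₕ c ≼ₕ a ⇒ₕ c := by
  rw [← res, Hoop.mul_comm]; exact trans (mul_mono_left _ h) (mp _ _)

lemma le_himp (a b : α) : b ≼ₕ a ⇒ₕ b := by
  rw [← res]; exact mul_le_left _ _

lemma le_dneg (a b : α) : a ≼ₕ (a ⇒ₕ b) ⇒ₕ b := by
  rw [← res]; exact mp _ _

lemma tneg (a b : α) : ((a ⇒ₕ b) ⇒ₕ b) ⇒ₕ b = a ⇒ₕ b :=
  antisymm (himp_anti_s12 b (le_dneg a b)) (le_dneg _ _)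

/-- Key step: if `x → z ≤ z → x` then `z ≤ x`. -/
lemma key0 {x z : α} (h : x ⇒ₕ z ≼ₕ z ⇒ₕ x) : z ≼ₕ x := by
  obtain ⟨t, ht⟩ : ∃ t, t = x ⇒ₕ z := ⟨_, rfl⟩
  obtain ⟨X, hX⟩ : ∃ X, X = t ⇒ₕ z := ⟨_, rfl⟩
  obtain ⟨k, hk⟩ : ∃ k, k = X ⇒ₕ x := ⟨_, rfl⟩
  have hzt : z ≼ₕ t := by rw [ht]; exact le_himp _ _
  have htX : t ⊗ₕ X = z := by rw [hX]; exact eq_of_le hzt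
  have hXz : X ⇒ₕ z = t := by rw [hX, ht]; exact tneg _ _
  have hxX : x ≼ₕ X := by rw [hX, ht]; exact le_dneg _ _
  have hXk : X ⊗ₕ k = x := by rw [hk]; exact eq_of_le hxX
  have hkt : k ⇒ₕ t = t := by
    rw [← hXz, Hoop.himp_himp, Hoop.mul_comm, hXk, hXz, ht]
  have htk : t ⇒ₕ k = z ⇒ₕ x := by rw [hk, Hoop.himp_himp, htX]
  have htR : t ≼ₕ t ⇒ₕ k := by rw [htk, ht]; exact h
  have h1 : (t ⇒ₕ k) ⇒ₕ t ≼ₕ t := by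
    have := himp_anti_s12 t (le_himp t k)
    rwa [hkt] at this
  have h2 : t ≼ₕ k := by
    have h3 := mul_mono_right (t ⇒ₕ k) h1
    rw [eq_of_le htR] at h3
    rw [Hoop.mul_comm] at h3
    exact trans h3 (mp _ _)
  rw [← htX, ← hXk, Hoop.mul_comm X k]
  exact mul_mono_left X h2

lemma key (x y : α) : (x ⇒ₕ y) ⇒ₕ (y ⇒ₕ x) ≼ₕ y ⇒ₕ x := by
  rw [← res]
  apply key0
  rw [← res]
  set D := (x ⇒ₕ y) ⇒ₕ (y ⇒ₕ x) with hD
  have h1 : x ⇒ₕ (D ⊗ₕ y) ≼ₕ x ⇒ₕ y := himp_mono_s12 x (mul_le_right _ _)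
  refine trans (mul_mono_left _ h1) ?_
  rw [← Hoop.mul_assoc, res]
  exact mp _ _

lemma exists_least [Finite α] (S : α → Prop) (a : α) (ha : S a)
    (hS : ∀ x y, S x → S y → S (x ⊗ₕ y)) :
    ∃ p, S p ∧ (∀ y, S y → p ≼ₕ y) ∧ p ⊗ₕ p = p := by
  let _ : PartialOrder α :=
    { le := Le, le_refl := le_refl, le_trans := fun _ _ _ => trans,
      le_antisymm := fun _ _ => antisymm }
  obtain ⟨p, hp, hmin⟩ := (Set.toFinite {x | S x}).exists_minimal ⟨a, ha⟩
  have hpy : ∀ y, S y → p ⊗ₕ y = p := fun y hy =>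
    antisymm (mul_le_left _ _) (hmin (hS p y hp hy) (mul_le_left _ _))
  refine ⟨p, hp, fun y hy => ?_, hpy p hp⟩
  rw [← hpy y hy]; exact mul_le_right _ _

lemma idem_mul_le {e x : α} (he : e ⊗ₕ e = e) (h : x ≼ₕ e) : e ⊗ₕ x = x := by
  rw [← eq_of_le h, ← Hoop.mul_assoc, he]

lemma idem_le_mul {e x : α} (he : e ⊗ₕ e = e) (h : e ≼ₕ x) : e ⊗ₕ x = e := by
  apply antisymm (mul_le_left _ _)
  have := mul_mono_right e h
  rwa [he] at this

lemma idem_himp [Finite α] {e f : α} (he : e ⊗ₕ e = e) (hf : f ⊗ₕ f = f) (hfe : f ≼ₕ e) :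
    (e ⇒ₕ f) ⊗ₕ (e ⇒ₕ f) = e ⇒ₕ f := by
  obtain ⟨s, hs⟩ : ∃ s, s = e ⇒ₕ f := ⟨_, rfl⟩
  rw [← hs]
  have hes : e ⊗ₕ s = f := by rw [hs]; exact eq_of_le hfe
  obtain ⟨p, ⟨hep, hpq⟩, hleast, hpp⟩ := exists_least
    (fun y : α => e ⊗ₕ y = f ∧ ∀ q, s ⇒ₕ q = q → y ⇒ₕ q = q) s ⟨hes, fun q hq => hq⟩ (by
      rintro x y ⟨hx1, hx2⟩ ⟨hy1, hy2⟩
      constructor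
      · have hfe' : f ⊗ₕ e = f := idem_le_mul hf hfe
        rw [← Hoop.mul_assoc, hx1, ← hfe', Hoop.mul_assoc, hy1, hf, hfe']
      · intro q hq
        rw [← Hoop.himp_himp, hy2 q hq, hx2 q hq])
  have hps : p ≼ₕ s := hleast s ⟨hes, fun q hq => hq⟩
  obtain ⟨m, hm⟩ : ∃ m, m = s ⇒ₕ p := ⟨_, rfl⟩
  have hsm : s ⊗ₕ m = p := by rw [hm]; exact eq_of_le hps
  have hem : e ≼ₕ m := by
    rw [hm, ← res, hes, ← hep]; exact mul_le_right _ _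
  have hms : m ⇒ₕ s ≼ₕ s := by
    nth_rewrite 2 [hs]
    rw [← res, Hoop.mul_comm, ← idem_le_mul he hem, Hoop.mul_assoc, ← hes]
    exact mul_mono_right e (mp _ _)
  have hq : s ⇒ₕ (s ⇒ₕ m) = s ⇒ₕ m :=
    antisymm (trans (himp_anti_s12 _ hms) (key m s)) (le_himp _ _)
  have h1 := hpq _ hq
  have hsm1 : s ≼ₕ m := by
    unfold Le
    rw [← h1, hm, himp_comm p s, himp_comm p s, Hoop.himp_self, himp_one_s12, himp_one_s12]
  have h2 : s ≼ₕ p := by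
    have h3 := mul_mono_right m hms
    rwa [eq_of_le hsm1, Hoop.mul_comm, hsm] at h3
  rw [antisymm h2 hps, hpp]

lemma absorb [Finite α] {e x c : α} (he : e ⊗ₕ e = e) (hx : x ≼ₕ e) (hc : x ⊗ₕ c = x) :
    e ⇒ₕ x ≼ₕ (e ⇒ₕ x) ⊗ₕ (e ⇒ₕ c) := by
  obtain ⟨f, hxf, hleast, hf⟩ := exists_least (fun y : α => x ⊗ₕ y = x) c hc (by
    intro y z hy hz
    rw [← Hoop.mul_assoc, hy, hz])
  have hfe : f ≼ₕ e := hleast e (by rw [Hoop.mul_comm]; exact idem_mul_le he hx)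
  have hxf' : x ≼ₕ f := by rw [← hxf]; exact mul_le_right _ _
  have hs := idem_himp he hf hfe
  have h1 := idem_mul_le hs (himp_mono_s12 e hxf')
  nth_rewrite 1 [← h1]
  rw [Hoop.mul_comm]
  exact mul_mono_right _ (himp_mono_s12 e (hleast c hc))

lemma himp_mul_le [Finite α] {e a : α} (b : α) (he : e ⊗ₕ e = e) (ha : a ≼ₕ e) :
    e ⇒ₕ (a ⊗ₕ b) = (e ⇒ₕ a) ⊗ₕ (e ⇒ₕ b) := by
  apply antisymm
  · have heu : (e ⇒ₕ a) ⊗ₕ e = a := by rw [Hoop.mul_comm]; exact eq_of_le ha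
    have huv : (e ⇒ₕ a) ⇒ₕ (e ⇒ₕ (a ⊗ₕ b)) = a ⇒ₕ (a ⊗ₕ b) := by
      rw [Hoop.himp_himp, heu]
    have hv := eq_of_le (himp_mono_s12 e (mul_le_left a b))
    rw [huv] at hv
    obtain ⟨b', hb'⟩ : ∃ b', b' = a ⇒ₕ (a ⊗ₕ b) := ⟨_, rfl⟩
    rw [← hb'] at hv
    have hbb : b ≼ₕ b' := by
      rw [hb', ← res, Hoop.mul_comm]; exact le_refl _
    have heb : e ⇒ₕ b' = b' := by
      rw [hb', Hoop.himp_himp, idem_mul_le he ha]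
    have hw : e ⇒ₕ b ≼ₕ b' := by
      have := himp_mono_s12 e hbb
      rwa [heb] at this
    have hw2 := eq_of_le hw
    rw [himp_comm] at hw2
    have hab : a ⊗ₕ b' = a ⊗ₕ b := by rw [hb']; exact eq_of_le (mul_le_left a b)
    rw [← hw2, ← Hoop.mul_assoc, hv]
    apply absorb he (trans (mul_le_left a b) ha)
    rw [← hab, Hoop.mul_assoc, eq_of_le hbb, hab]
  · have heu : e ⊗ₕ (e ⇒ₕ a) = a := eq_of_le ha
    have h1 : ((e ⇒ₕ a) ⊗ₕ (e ⇒ₕ b)) ⊗ₕ e = a ⊗ₕ (e ⊗ₕ (e ⇒ₕ b)) := by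
      rw [← Hoop.mul_assoc a e, Hoop.mul_comm a e, idem_mul_le he ha, Hoop.mul_comm,
        ← Hoop.mul_assoc, heu]
    rw [← res, h1]
    exact mul_mono_right a (mp _ _)

lemma himp_idem_mul {e : α} (he : e ⊗ₕ e = e) (a : α) : e ⇒ₕ (e ⊗ₕ a) = e ⇒ₕ a := by
  apply antisymm (himp_mono_s12 e (mul_le_right _ _))
  rw [← res, Hoop.mul_comm]
  nth_rewrite 1 [← he]
  rw [Hoop.mul_assoc]
  exact mul_mono_right e (mp _ _)

lemma himp_mul [Finite α] {e : α} (he : e ⊗ₕ e = e) (a b : α) :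
    e ⇒ₕ (a ⊗ₕ b) = (e ⇒ₕ a) ⊗ₕ (e ⇒ₕ b) := by
  rw [← himp_idem_mul he (a ⊗ₕ b), ← himp_idem_mul he a, ← Hoop.mul_assoc]
  exact himp_mul_le b he (mul_le_left e a)

lemma himp_distrib {e : α} (he : e ⊗ₕ e = e) (a b : α) :
    e ⇒ₕ (a ⇒ₕ b) = (e ⇒ₕ a) ⇒ₕ (e ⇒ₕ b) := by
  have h : e ⊗ₕ (e ⇒ₕ a) = e ⊗ₕ a := by
    apply antisymm
    · nth_rewrite 1 [← he]
      rw [Hoop.mul_assoc]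
      exact mul_mono_right e (mp _ _)
    · exact mul_mono_right e (le_himp _ _)
  rw [himp_comm (e ⇒ₕ a), Hoop.himp_himp, Hoop.himp_himp, h]

end

lemma retract (A B : Type) [Hoop A] [Hoop B]
    [Finite B] (g : B → A) (hg : IsHoopHom g)
    (hgsurj : Function.Surjective g) : ∃ h : A → B, IsHoopHom h ∧ g ∘ h = id := by
  obtain ⟨hmul, himp, hone⟩ := hg
  obtain ⟨e, hge, hleast, he⟩ := exists_least (fun y : B => g y = Hoop.one) Hoop.one hone (by
    intro x y hx hy
    rw [hmul, hx, hy, Hoop.mul_one])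
  choose k hk using hgsurj
  have hle : ∀ x y, g x = g y → e ⇒ₕ x ≼ₕ e ⇒ₕ y := by
    intro x y hxy
    have h1 : e ≼ₕ x ⇒ₕ y := hleast _ (by rw [himp, hxy, Hoop.himp_self])
    rw [← himp_idem_mul he x]
    have h2 := res.2 h1
    rw [← himp_idem_mul he y, ← res, Hoop.mul_comm]
    refine trans (mp _ _) ?_
    rw [← he, Hoop.mul_assoc, he]
    exact mul_mono_right e h2
  have hwd : ∀ x y, g x = g y → e ⇒ₕ x = e ⇒ₕ y :=
    fun x y h => antisymm (hle x y h) (hle y x h.symm)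
  refine ⟨fun a => e ⇒ₕ k a, ⟨?_, ?_, ?_⟩, ?_⟩
  · intro a b
    show e ⇒ₕ k (a ⊗ₕ b) = (e ⇒ₕ k a) ⊗ₕ (e ⇒ₕ k b)
    rw [← himp_mul he]
    apply hwd
    rw [hmul, hk, hk, hk]
  · intro a b
    show e ⇒ₕ k (a ⇒ₕ b) = (e ⇒ₕ k a) ⇒ₕ (e ⇒ₕ k b)
    rw [← himp_distrib he]
    apply hwd
    rw [himp, hk, hk, hk]
  · show e ⇒ₕ k Hoop.one = Hoop.one
    rw [hwd (k Hoop.one) Hoop.one (by rw [hk, hone]), himp_one_s12]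
  · funext a
    show g (e ⇒ₕ k a) = a
    rw [himp, hge, hk, one_himp_s12]

/-- Pullback of hoop homomorphisms. -/
@[reducible] def pullback {A B C : Type} [Hoop A] [Hoop B] [Hoop C] (h : A → C) (g : B → C)
    (hh : IsHoopHom h) (hg : IsHoopHom g) : Hoop {p : A × B // h p.1 = g p.2} where
  mul p q := ⟨(p.1.1 ⊗ₕ q.1.1, p.1.2 ⊗ₕ q.1.2), by
    show h _ = g _
    rw [hh.1, hg.1, p.2, q.2]⟩
  himp p q := ⟨(p.1.1 ⇒ₕ q.1.1, p.1.2 ⇒ₕ q.1.2), by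
    show h _ = g _
    rw [hh.2.1, hg.2.1, p.2, q.2]⟩
  one := ⟨(Hoop.one, Hoop.one), by
    show h _ = g _
    rw [hh.2.2, hg.2.2]⟩
  mul_comm a b := Subtype.ext (Prod.ext (Hoop.mul_comm _ _) (Hoop.mul_comm _ _))
  mul_assoc a b c := Subtype.ext (Prod.ext (Hoop.mul_assoc _ _ _) (Hoop.mul_assoc _ _ _))
  mul_one a := Subtype.ext (Prod.ext (Hoop.mul_one _) (Hoop.mul_one _))
  himp_self a := Subtype.ext (Prod.ext (Hoop.himp_self _) (Hoop.himp_self _))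
  div a b := Subtype.ext (Prod.ext (Hoop.div _ _) (Hoop.div _ _))
  himp_himp a b c := Subtype.ext (Prod.ext (Hoop.himp_himp _ _ _) (Hoop.himp_himp _ _ _))

lemma projective (A B C : Type) [Hoop A] [Hoop B] [Hoop C] [Finite A] [Finite B]
    (h : A → C) (g : B → C) (hh : IsHoopHom h) (hg : IsHoopHom g)
    (hs : Function.Surjective g) : ∃ f : A → B, IsHoopHom f ∧ g ∘ f = h := by
  let _ := pullback h g hh hg
  obtain ⟨k, hk, hk2⟩ := retract A {p : A × B // h p.1 = g p.2} (fun p => p.1.1)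
    ⟨fun _ _ => rfl, fun _ _ => rfl, rfl⟩ (by
      intro a
      obtain ⟨b, hb⟩ := hs (h a)
      exact ⟨⟨(a, b), hb.symm⟩, rfl⟩)
  refine ⟨fun a => (k a).1.2, ⟨?_, ?_, ?_⟩, ?_⟩
  · intro a b
    show (k (a ⊗ₕ b)).1.2 = _
    rw [hk.1]; rfl
  · intro a b
    show (k (a ⇒ₕ b)).1.2 = _
    rw [hk.2.1]; rfl
  · show (k Hoop.one).1.2 = _
    rw [hk.2.2]; rfl
  · funext a
    show g (k a).1.2 = h a
    rw [← (k a).2]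
    exact congrArg h (congrFun hk2 a)

end HoopAux

/-- Any finite hoop `A` is a retract of any finite hoop `B` of which it is a
homomorphic image; consequently, every finite hoop is projective in the class
of all finite hoops. -/
theorem finite_hoop_retract_and_projective (A B : Type) [Hoop A] [Hoop B]
    [Finite A] [Finite B] (g : B → A) (hg : IsHoopHom g)
    (hgsurj : Function.Surjective g) :
    (∃ h : A → B, IsHoopHom h ∧ g ∘ h = id) ∧
    (∀ (A' : Type) [Hoop A'] [Finite A'],
      ∀ (B' C' : Type) [Hoop B'] [Hoop C'] [Finite B'] [Finite C'],
        ∀ (h : A' → C') (g' : B' → C'), IsHoopHom h → IsHoopHom g' →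
          Function.Surjective g' →
            ∃ f : A' → B', IsHoopHom f ∧ g' ∘ f = h) := by
  exact ⟨HoopAux.retract A B g hg hgsurj, fun A' _ _ B' C' _ _ _ _ h g' hh hg' hs =>
    HoopAux.projective A' B' C' h g' hh hg' hs⟩
end

section
/- Every bounded hoop satisfies the quasi-identity: for all x, y, if x·x = x then (x → y) → ¬¬x = ¬¬x. -/
/-- A bounded hoop: a hoop with a least element `0` (i.e. `0 → x = 1`). -/
class BHoop (α : Type) extends Hoop α where
  zero : α
  zero_himp : ∀ a : α, himp zero a = one

/-- A bounded hoop homomorphism preserves `·`, `→`, `1` and `0`. -/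
def IsBHoopHom {α β : Type} [BHoop α] [BHoop β] (f : α → β) : Prop :=
  (∀ a b : α, f (Hoop.mul a b) = Hoop.mul (f a) (f b)) ∧
  (∀ a b : α, f (Hoop.himp a b) = Hoop.himp (f a) (f b)) ∧
  f Hoop.one = Hoop.one ∧ f BHoop.zero = BHoop.zero

/-- Negation in a bounded hoop: `¬x = x → 0`. -/
def BHoop.neg {α : Type} [BHoop α] (a : α) : α := Hoop.himp a BHoop.zero

section helpers
open Hoop BHoop
variable {A : Type} [BHoop A]

theorem bh_himp_one (a : A) : himp a (one : A) = one := by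
  rw [← zero_himp (zero : A), Hoop.himp_himp, Hoop.mul_comm, ← Hoop.himp_himp, zero_himp, zero_himp]

theorem bh_one_himp (a : A) : himp one a = a := by
  have h := Hoop.div (one : A) a
  rw [bh_himp_one, Hoop.mul_one, Hoop.mul_comm, Hoop.mul_one] at h
  exact h

theorem bh_antisymm {a b : A} (h1 : himp a b = one) (h2 : himp b a = one) : a = b := by
  have h := Hoop.div a b
  rwa [h1, h2, Hoop.mul_one, Hoop.mul_one] at h

theorem bh_swap (a b c : A) : himp a (himp b c) = himp b (himp a c) := by
  rw [Hoop.himp_himp, Hoop.himp_himp, Hoop.mul_comm]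

theorem bh_weak (a b : A) : himp a (himp b a) = one := by
  rw [bh_swap, Hoop.himp_self, bh_himp_one]

theorem bh_anti {a b : A} (h : himp a b = one) (e : A) :
    himp (himp b e) (himp a e) = one := by
  have h3 : a = mul (himp b a) b := by
    have h' := Hoop.div a b
    rw [h, Hoop.mul_one, Hoop.mul_comm] at h'
    exact h'
  have h4 : himp a e = himp (himp b a) (himp b e) := by
    rw [Hoop.himp_himp, ← h3]
  rw [h4, bh_weak]

theorem bh_dn (a b : A) : himp a (himp (himp a b) b) = one := by
  rw [bh_swap, Hoop.himp_self]

theorem bh_triple (a b : A) : himp (himp (himp a b) b) b = himp a b :=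
  bh_antisymm (bh_anti (bh_dn a b) b) (bh_dn _ _)

end helpers

/-- Every bounded hoop satisfies the quasi-identity
`x·x = x  ⟹  (x → y) → ¬¬x = ¬¬x`. -/
theorem bounded_hoop_quasi_identity (A : Type) [BHoop A] (x y : A)
    (hx : Hoop.mul x x = x) :
    Hoop.himp (Hoop.himp x y) (BHoop.neg (BHoop.neg x)) =
      BHoop.neg (BHoop.neg x) := by
  unfold BHoop.neg
  obtain ⟨a, ha⟩ : ∃ a, a = Hoop.himp x BHoop.zero := ⟨_, rfl⟩
  obtain ⟨e, he⟩ : ∃ e, e = Hoop.himp a BHoop.zero := ⟨_, rfl⟩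
  have hea : Hoop.himp e BHoop.zero = a := by rw [he, ha, bh_triple]
  have h1 : Hoop.himp e a = a := by
    rw [ha, bh_swap, hea, ha, Hoop.himp_himp, hx]
  have h2 : Hoop.himp (Hoop.himp a e) e = Hoop.one := by
    have hd := Hoop.div a e
    rw [h1] at hd
    have : Hoop.himp (Hoop.himp a e) (Hoop.himp a BHoop.zero) = Hoop.one := by
      rw [Hoop.himp_himp, Hoop.mul_comm, hd, ← Hoop.himp_himp, ← he, Hoop.himp_self]
    rwa [← he] at this
  have h3 : Hoop.himp a e = e := bh_antisymm h2 (bh_weak _ _)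
  have h4 : Hoop.himp a (Hoop.himp x y) = Hoop.one := by
    rw [Hoop.himp_himp, Hoop.mul_comm, ha, Hoop.div, BHoop.zero_himp, Hoop.mul_one,
      BHoop.zero_himp]
  have h5 := bh_anti h4 e
  rw [h3] at h5
  rw [← ha, ← he]
  exact bh_antisymm h5 (bh_weak _ _)
end

section
/- Let A be a Heyting algebra projective in HA and let C ⊆ A be an infinite subset closed under ⇨ (i.e., x, y ∈ C implies x ⇨ y ∈ C). Then ⊤ is the only upper bound of C \ {⊤}: if a ∈ A satisfies c ≤ a for every c ∈ C with c ≠ ⊤, then a = ⊤. -/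
namespace HProj

/-- Heyting terms with variables in `A`. -/
inductive Term (A : Type) : Type
  | var : A → Term A
  | bot : Term A
  | inf : Term A → Term A → Term A
  | sup : Term A → Term A → Term A
  | imp : Term A → Term A → Term A

/-- Evaluation of a term. -/
def Term.eval {A H : Type} [HeytingAlgebra H] (v : A → H) : Term A → H
  | .var x => v x
  | .bot => ⊥
  | .inf s t => s.eval v ⊓ t.eval v
  | .sup s t => s.eval v ⊔ t.eval v
  | .imp s t => s.eval v ⇨ t.eval v

/-- Values in `A` of all subterms. -/
def Term.vals {A : Type} [HeytingAlgebra A] : Term A → Set A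
  | .var x => {x}
  | .bot => {⊥}
  | .inf s t => insert (s.eval id ⊓ t.eval id) (s.vals ∪ t.vals)
  | .sup s t => insert (s.eval id ⊔ t.eval id) (s.vals ∪ t.vals)
  | .imp s t => insert (s.eval id ⇨ t.eval id) (s.vals ∪ t.vals)

theorem Term.vals_finite {A : Type} [HeytingAlgebra A] (t : Term A) : t.vals.Finite := by
  induction t with
  | var x => exact Set.finite_singleton _
  | bot => exact Set.finite_singleton _
  | inf s t hs ht => exact (hs.union ht).insert _
  | sup s t hs ht => exact (hs.union ht).insert _
  | imp s t hs ht => exact (hs.union ht).insert _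

theorem Term.eval_mem_vals {A : Type} [HeytingAlgebra A] (t : Term A) :
    t.eval id ∈ t.vals := by
  cases t <;> simp [Term.eval, Term.vals]

/-- Finite bounded sublattices of `A`. -/
structure FinSub (A : Type) [HeytingAlgebra A] where
  L : Sublattice A
  fin : (L : Set A).Finite
  bot_mem : ⊥ ∈ L
  top_mem : ⊤ ∈ L

variable {A : Type} [HeytingAlgebra A]

/-- The underlying type of a finite bounded sublattice. -/
abbrev FinSub.Carrier (S : FinSub A) : Type := S.L

instance (S : FinSub A) : Finite S.Carrier := S.fin

/-- The bounds. -/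
abbrev FinSub.bounded (S : FinSub A) : BoundedOrder S.Carrier where
  top := ⟨⊤, S.top_mem⟩
  bot := ⟨⊥, S.bot_mem⟩
  le_top x := (le_top : (x : A) ≤ ⊤)
  bot_le x := (bot_le : ⊥ ≤ (x : A))

open Classical in
noncomputable instance FinSub.heyting (S : FinSub A) : HeytingAlgebra S.Carrier :=
  letI := S.bounded
  letI := Fintype.ofFinite S.Carrier
  HeytingAlgebra.ofHImp
    (fun x y => (Finset.univ.filter (fun z : S.Carrier => z ⊓ x ≤ y)).sup id) (by
      intro a b c
      constructor
      · intro h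
        refine (inf_le_inf_right b h).trans ?_
        rw [Finset.sup_inf_distrib_right]
        refine Finset.sup_le ?_
        intro z hz
        simpa using hz
      · intro h
        exact Finset.le_sup (f := id) (by simpa using h))

theorem FinSub.coe_himp (S : FinSub A) (x y : S.Carrier) (h : (x : A) ⇨ (y : A) ∈ S.L) :
    ((x ⇨ y : S.Carrier) : A) = (x : A) ⇨ (y : A) := by
  apply le_antisymm
  · rw [le_himp_iff]
    have : (x ⇨ y) ⊓ x ≤ y := himp_inf_le
    exact this
  · have : (⟨(x : A) ⇨ (y : A), h⟩ : S.Carrier) ≤ x ⇨ y := by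
      rw [le_himp_iff]
      exact (himp_inf_le : ((x : A) ⇨ (y : A)) ⊓ (x : A) ≤ y)
    exact this

open Classical in
/-- The canonical valuation. -/
noncomputable def FinSub.v (S : FinSub A) (x : A) : S.Carrier :=
  if h : x ∈ S.L then ⟨x, h⟩ else ⊥

theorem FinSub.eval_v (S : FinSub A) (t : Term A) (h : t.vals ⊆ S.L) :
    ((t.eval S.v : S.Carrier) : A) = t.eval id := by
  induction t with
  | var x =>
    have hx : x ∈ S.L := h rfl
    simp [Term.eval, FinSub.v, hx]
  | bot => rfl
  | inf s t hs ht =>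
    simp only [Term.vals, Set.insert_subset_iff, Set.union_subset_iff] at h
    simp only [Term.eval]
    rw [← hs h.2.1, ← ht h.2.2]; rfl
  | sup s t hs ht =>
    simp only [Term.vals, Set.insert_subset_iff, Set.union_subset_iff] at h
    simp only [Term.eval]
    rw [← hs h.2.1, ← ht h.2.2]; rfl
  | imp s t hs ht =>
    simp only [Term.vals, Set.insert_subset_iff, Set.union_subset_iff] at h
    have h1 := h.1
    simp only [Term.eval]
    rw [← hs h.2.1, ← ht h.2.2] at h1 ⊢
    exact S.coe_himp _ _ h1

theorem exists_finSub (s : Set A) (hs : s.Finite) : ∃ S : FinSub A, s ⊆ S.L := by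
  have hsub : insert ⊥ (insert ⊤ s) ⊆ latticeClosure (insert ⊥ (insert ⊤ s)) :=
    subset_latticeClosure
  refine ⟨⟨⟨latticeClosure (insert ⊥ (insert ⊤ s)), isSublattice_latticeClosure.1,
    isSublattice_latticeClosure.2⟩, ((hs.insert _).insert _).latticeClosure,
    hsub (by simp), hsub (by simp)⟩, ?_⟩
  intro x hx
  exact hsub (by simp [hx])

variable (A) in
/-- The product of all finite bounded sublattices, over all valuations. -/
abbrev Prod : Type := ∀ i : (Σ S : FinSub A, (A → S.Carrier)), i.1.Carrier

/-- Evaluation in the product. -/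
noncomputable def ev (t : Term A) : Prod A := fun i => t.eval i.2

theorem ev_sound (s t : Term A) (h : ev s = ev t) : s.eval id = t.eval id := by
  obtain ⟨S, hS⟩ := exists_finSub (s.vals ∪ t.vals) (s.vals_finite.union t.vals_finite)
  rw [Set.union_subset_iff] at hS
  rw [← S.eval_v s hS.1, ← S.eval_v t hS.2]
  exact congrArg Subtype.val (congrFun h ⟨S, S.v⟩)

variable (A) in
/-- The image of the term algebra. -/
def Fr : Type := {f : Prod A // ∃ t, ev t = f}

noncomputable instance : Max (Fr A) :=
  ⟨fun x y => ⟨x.1 ⊔ y.1, by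
    obtain ⟨_, s, rfl⟩ := x; obtain ⟨_, t, rfl⟩ := y; exact ⟨.sup s t, rfl⟩⟩⟩
noncomputable instance : Min (Fr A) :=
  ⟨fun x y => ⟨x.1 ⊓ y.1, by
    obtain ⟨_, s, rfl⟩ := x; obtain ⟨_, t, rfl⟩ := y; exact ⟨.inf s t, rfl⟩⟩⟩
noncomputable instance : HImp (Fr A) :=
  ⟨fun x y => ⟨x.1 ⇨ y.1, by
    obtain ⟨_, s, rfl⟩ := x; obtain ⟨_, t, rfl⟩ := y; exact ⟨.imp s t, rfl⟩⟩⟩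
noncomputable instance : Bot (Fr A) := ⟨⟨⊥, .bot, rfl⟩⟩
noncomputable instance : Top (Fr A) := ⟨⟨⊤, .imp .bot .bot, by
  funext i; exact himp_self⟩⟩
noncomputable instance : Compl (Fr A) := ⟨fun x => ⟨x.1ᶜ, by
  obtain ⟨_, s, rfl⟩ := x
  exact ⟨.imp s .bot, by funext i; exact himp_bot _⟩⟩⟩
instance : LE (Fr A) := ⟨fun x y => x.1 ≤ y.1⟩
instance : LT (Fr A) := ⟨fun x y => x.1 < y.1⟩

noncomputable instance : HeytingAlgebra (Fr A) :=
  Function.Injective.heytingAlgebra (fun x : Fr A => x.1) Subtype.val_injective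
    Iff.rfl Iff.rfl (fun _ _ => rfl) (fun _ _ => rfl) rfl rfl (fun _ => rfl) (fun _ _ => rfl)

/-- The map to `A`. -/
noncomputable def gf (x : Fr A) : A := x.2.choose.eval id

theorem gf_eq (x : Fr A) (t : Term A) (h : ev t = x.1) : gf x = t.eval id :=
  ev_sound _ _ (x.2.choose_spec.trans h.symm)

/-- The surjection to `A`. -/
noncomputable def g : HeytingHom (Fr A) A where
  toFun := gf
  map_sup' x y := by
    obtain ⟨s, hs⟩ := x.2; obtain ⟨t, ht⟩ := y.2
    rw [gf_eq x s hs, gf_eq y t ht, gf_eq (x ⊔ y) (.sup s t)]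
    · rfl
    · change _ = x.1 ⊔ y.1
      rw [← hs, ← ht]; rfl
  map_inf' x y := by
    obtain ⟨s, hs⟩ := x.2; obtain ⟨t, ht⟩ := y.2
    rw [gf_eq x s hs, gf_eq y t ht, gf_eq (x ⊓ y) (.inf s t)]
    · rfl
    · change _ = x.1 ⊓ y.1
      rw [← hs, ← ht]; rfl
  map_bot' := gf_eq ⊥ .bot rfl
  map_himp' x y := by
    obtain ⟨s, hs⟩ := x.2; obtain ⟨t, ht⟩ := y.2
    rw [gf_eq x s hs, gf_eq y t ht, gf_eq (x ⇨ y) (.imp s t)]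
    · rfl
    · change _ = x.1 ⇨ y.1
      rw [← hs, ← ht]; rfl

theorem g_surj : Function.Surjective (g : HeytingHom (Fr A) A) := fun a =>
  ⟨⟨ev (.var a), _, rfl⟩, gf_eq _ (.var a) rfl⟩

end HProj

/-- If `A` is projective in HA and `C ⊆ A` is infinite and closed under `⇨`,
then the only upper bound of `C \ {⊤}` is `⊤`. -/
theorem projective_Heyting_infinite_himp_closed (A : Type) [HeytingAlgebra A]
    (hproj : HeytingProjective A) (C : Set A) (hinf : C.Infinite)
    (hclosed : ∀ x ∈ C, ∀ y ∈ C, x ⇨ y ∈ C)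
    (a : A) (hub : ∀ c ∈ C, c ≠ ⊤ → c ≤ a) : a = ⊤ := by
  obtain ⟨f, hf⟩ := hproj (HProj.Fr A) A (HeytingHom.id A) HProj.g HProj.g_surj
  by_contra ha
  have hfa : (f a).1 ≠ ⊤ := by
    intro h
    have h1 : f a = ⊤ := Subtype.ext h
    apply ha
    have h2 := hf a
    rw [h1, map_top] at h2
    exact h2.symm
  obtain ⟨i, hi⟩ := Function.ne_iff.1 hfa
  have key : ∀ x ∈ C, ∀ y ∈ C, (f x).1 i ≤ (f y).1 i → x ≤ y := by
    intro x hx y hy hxy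
    by_contra hn
    have h1 : x ⇨ y ≤ a := hub _ (hclosed x hx y hy) (fun h => hn (himp_eq_top_iff.1 h))
    have h2 : f (x ⇨ y) ≤ f a := OrderHomClass.mono f h1
    rw [map_himp] at h2
    have h3 : (f x).1 i ⇨ (f y).1 i ≤ (f a).1 i := h2 i
    rw [himp_eq_top_iff.2 hxy] at h3
    exact hi (top_le_iff.1 h3)
  apply hinf
  refine Set.Finite.of_finite_image (f := fun x => (f x).1 i) (Set.toFinite _) ?_
  intro x hx y hy hxy
  exact le_antisymm (key x hx y hy (le_of_eq hxy)) (key y hy x hx (le_of_eq hxy.symm))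
end
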